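/- Let G be a finite group. If every maximal subgroup of G is either modular in G or S-quasinormal in G, or if every 2-maximal subgroup of G is either modular in G or S-quasinormal in G, then G is nearly nilpotent (and hence strongly supersoluble). -/

import Mathlib

open Subgroup Pointwise

variable {G : Type*} [Group G]

/-- A subgroup `M` of `G` is modular if it is a modular element of the lattice of
subgroups of `G`. -/
def IsModularSubgroup (M : Subgroup G) : Prop :=
  (∀ X Z : Subgroup G, X ≤ Z → X ⊔ (M ⊓ Z) = (X ⊔ M) ⊓ Z) ∧
  (∀ Y Z : Subgroup G, M ≤ Z → M ⊔ (Y ⊓ Z) = (M ⊔ Y) ⊓ Z)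

/-- A subgroup `H` of `G` is S-quasinormal if `HP = PH` for every Sylow subgroup `P` of `G`. -/
def IsSQuasinormal (H : Subgroup G) : Prop :=
  ∀ (p : ℕ), p.Prime → ∀ P : Sylow p G,
    (H : Set G) * ((P : Subgroup G) : Set G) = ((P : Subgroup G) : Set G) * (H : Set G)

/-- `H` is a maximal subgroup of `K` (both being subgroups of the ambient group `G`). -/
def IsMaximalIn (K H : Subgroup G) : Prop :=
  H < K ∧ ∀ L : Subgroup G, H < L → L ≤ K → L = K

/-- `H` is an `n`-maximal subgroup of `G`: there is a chain
`H = M_n < … < M_1 < M_0 = G` with `M_i` maximal in `M_{i-1}` for all `i`. -/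
def IsNMaximal (n : ℕ) (H : Subgroup G) : Prop :=
  ∃ M : Fin (n + 1) → Subgroup G,
    M 0 = ⊤ ∧ M (Fin.last n) = H ∧
    ∀ i : Fin n, IsMaximalIn (M i.castSucc) (M i.succ)

/-- A group is supersoluble if it has a normal series with cyclic factors. -/
def IsSupersoluble (G : Type*) [Group G] : Prop :=
  ∃ (n : ℕ) (s : Fin (n + 1) → Subgroup G) (_hnorm : ∀ i, (s i).Normal),
    s 0 = ⊥ ∧ s (Fin.last n) = ⊤ ∧
    ∀ i : Fin n, s i.castSucc ≤ s i.succ ∧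
      haveI := _hnorm i.castSucc
      IsCyclic ↥((s i.succ).map (QuotientGroup.mk' (s i.castSucc)))

/-- `H/K` is a chief factor of `G`: both are normal in `G`, `K < H`, and there is no
normal subgroup of `G` strictly between `K` and `H` (i.e. `H/K` is a minimal normal
subgroup of `G/K`). -/
def IsChiefFactor (H K : Subgroup G) : Prop :=
  K.Normal ∧ H.Normal ∧ K < H ∧
    ∀ N : Subgroup G, N.Normal → K < N → N ≤ H → N = H

/-- The centralizer `C_G(H/K)` of a factor `H/K`: the preimage in `G` of the
centralizer of `HK/K` in `G/K`. -/
def chiefCentralizer (H K : Subgroup G) (hK : K.Normal) : Subgroup G :=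
  haveI := hK
  Subgroup.comap (QuotientGroup.mk' K)
    (Subgroup.centralizer ((H.map (QuotientGroup.mk' K) : Subgroup (G ⧸ K)) : Set (G ⧸ K)))

/-- The factor `H/K` is non-Frattini, i.e. `HK/K ≰ Φ(G/K)`. -/
def IsNonFrattini (H K : Subgroup G) (hK : K.Normal) : Prop :=
  haveI := hK
  ¬ H.map (QuotientGroup.mk' K) ≤ frattini (G ⧸ K)

/-- A group is strongly supersoluble if it is supersoluble and the automorphism group
`G/C_G(H/K)` induced by `G` on any chief factor `H/K` has square-free order. -/
def IsStronglySupersoluble (G : Type*) [Group G] : Prop :=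
  IsSupersoluble G ∧
    ∀ H K : Subgroup G, ∀ hc : IsChiefFactor H K,
      Squarefree (chiefCentralizer H K hc.1).index

/-- A group is nearly nilpotent if it is supersoluble and the automorphism group
`G/C_G(H/K)` induced by `G` on any non-Frattini chief factor `H/K` has order dividing
a prime. -/
def IsNearlyNilpotent (G : Type*) [Group G] : Prop :=
  IsSupersoluble G ∧
    ∀ H K : Subgroup G, ∀ hc : IsChiefFactor H K, IsNonFrattini H K hc.1 →
      ∃ p : ℕ, p.Prime ∧ (chiefCentralizer H K hc.1).index ∣ p

/-- The strongly supersoluble residual `G^{U_s}`: the intersection of all normal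
subgroups `N` of `G` with `G/N` strongly supersoluble. -/
def ssResidual (G : Type*) [Group G] : Subgroup G :=
  sInf {N : Subgroup G | ∃ _hN : N.Normal,
    haveI := _hN
    IsStronglySupersoluble (G ⧸ N)}

open scoped commutatorElement

/-- The number `n` is of the form `p * q` with `p` prime and `q < p` either prime or `1`. -/
def IsPrimeMulSmaller (n : ℕ) : Prop :=
  ∃ p q : ℕ, p.Prime ∧ (q = 1 ∨ q.Prime) ∧ q < p ∧ n = p * q

/-- Every maximal subgroup has a core of index `p * q`, with `p` prime and `q < p` either prime
or `1`. -/
def HasSmallCoatomCores (G : Type*) [Group G] : Prop :=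
  ∀ M : Subgroup G, IsCoatom M → IsPrimeMulSmaller M.normalCore.index

/-- The first half of modularity, in the form it takes for a maximal subgroup. -/
def IsCoatomModular (M : Subgroup G) : Prop :=
  ∀ X Z : Subgroup G, X ≤ Z → ¬ X ≤ M → X ⊔ (M ⊓ Z) = Z

theorem IsPrimeMulSmaller.squarefree {n : ℕ} (h : IsPrimeMulSmaller n) : Squarefree n := by
  obtain ⟨p, q, hp, hq, hqp, rfl⟩ := h
  have hc : Nat.Coprime p q := by
    rcases hq with rfl | hq
    · simp
    · exact (Nat.coprime_primes hp hq).2 hqp.ne'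
  rw [Nat.squarefree_mul hc]
  refine ⟨hp.prime.squarefree, ?_⟩
  rcases hq with rfl | hq
  · exact squarefree_one
  · exact hq.prime.squarefree

theorem Nat.Prime.isPrimeMulSmaller {p : ℕ} (hp : p.Prime) : IsPrimeMulSmaller p :=
  ⟨p, 1, hp, Or.inl rfl, hp.one_lt, (mul_one p).symm⟩

theorem IsModularSubgroup.isCoatomModular {M : Subgroup G} (h : IsModularSubgroup M)
    (hM : IsCoatom M) : IsCoatomModular M := by
  intro X Z hXZ hX
  rw [h.1 X Z hXZ, hM.2 (X ⊔ M) (lt_of_le_of_ne le_sup_right fun he => hX (he ▸ le_sup_left)),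
    top_inf_eq]

theorem IsCoatomModular.isCoatom {M : Subgroup G} (h : IsCoatomModular M) (hM : M ≠ ⊤) :
    IsCoatom M := by
  refine ⟨hM, fun X hX => ?_⟩
  have := h X ⊤ le_top (not_le_of_gt hX)
  rwa [inf_top_eq, sup_eq_left.2 hX.le] at this

theorem IsCoatomModular.comap {H : Type*} [Group H] {M : Subgroup G} (h : IsCoatomModular M)
    {f : H →* G} (hf : Function.Injective f) : IsCoatomModular (M.comap f) := by
  intro X Z hXZ hX
  apply map_injective hf
  rw [Subgroup.map_sup, map_inf _ _ _ hf, map_comap_eq]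
  have h1 : f.range ⊓ M ⊓ Z.map f = M ⊓ Z.map f := by
    rw [inf_comm f.range, inf_assoc, inf_eq_right.2 (map_le_range f Z)]
  rw [h1]
  exact h _ _ (map_mono hXZ) fun hle => hX (map_le_iff_le_comap.1 hle)

theorem IsCoatomModular.of_comap {H : Type*} [Group H] {M : Subgroup H} {f : G →* H}
    (hf : Function.Surjective f) (h : IsCoatomModular (M.comap f)) : IsCoatomModular M := by
  intro X Z hXZ hX
  apply comap_injective hf
  rw [← comap_sup_eq _ _ _ hf, comap_inf]
  exact h _ _ (comap_mono hXZ) fun hle => hX ((comap_le_comap_of_surjective hf).1 hle)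

theorem Subgroup.commutator_le_of_relIndex_prime {R S : Subgroup G} [R.Normal]
    (h : (R.relIndex S).Prime) : ⁅S, S⁆ ≤ R := by
  rw [commutator_le]
  intro a ha b hb
  have := Fact.mk h
  have hc : IsCyclic (S ⧸ R.subgroupOf S) := isCyclic_of_prime_card (p := R.relIndex S) rfl
  have hab := hc.isMulCommutative.is_comm.comm (⟨a, ha⟩ : S) (⟨b, hb⟩ : S)
  rw [← QuotientGroup.mk_mul, ← QuotientGroup.mk_mul, eq_comm, QuotientGroup.eq, mem_subgroupOf]
    at hab
  have h1 := ‹R.Normal›.conj_mem _ hab (b * a)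
  simpa [commutatorElement_def, mul_assoc] using h1

theorem exists_normal_card_eq_of_card_eq_mul [Finite G] {p q : ℕ} (hp : p.Prime) (hq : 0 < q)
    (hqp : q < p) (hG : Nat.card G = p * q) : ∃ S : Subgroup G, S.Normal ∧ Nat.card S = p := by
  have := Fact.mk hp
  obtain ⟨P⟩ : Nonempty (Sylow p G) := inferInstance
  have hf : (Nat.card G).factorization p = 1 := by
    rw [hG, Nat.factorization_mul hp.ne_zero hq.ne', Finsupp.add_apply, hp.factorization_self,
      Nat.factorization_eq_zero_of_not_dvd (Nat.not_dvd_of_pos_of_lt hq hqp)]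
  have hP : Nat.card P = p := by rw [P.card_eq_multiplicity, hf, pow_one]
  have hi : (P : Subgroup G).index = q := by
    have := (P : Subgroup G).card_mul_index
    rw [hP, hG] at this
    exact Nat.eq_of_mul_eq_mul_left hp.pos this
  have h1 : Nat.card (Sylow p G) ≤ q := Nat.le_of_dvd hq (hi ▸ P.card_dvd_index)
  have h2 : Nat.card (Sylow p G) = 1 :=
    Nat.ModEq.eq_of_lt_of_lt (card_sylow_modEq_one p G) (h1.trans_lt hqp) hp.one_lt
  have := (Nat.card_eq_one_iff_unique.1 h2).1
  exact ⟨P, P.normal_of_subsingleton, hP⟩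

theorem exists_normal_between_of_index_eq [Finite G] {R : Subgroup G} [R.Normal] {p q : ℕ}
    (hp : p.Prime) (hq : 0 < q) (hqp : q < p) (hR : R.index = p * q) :
    ∃ S : Subgroup G, S.Normal ∧ R ≤ S ∧ S.index = q ∧ R.relIndex S = p ∧ ⁅S, S⁆ ≤ R := by
  obtain ⟨S, hS, hc⟩ := exists_normal_card_eq_of_card_eq_mul (G := G ⧸ R) hp hq hqp hR
  have hle : R ≤ S.comap (QuotientGroup.mk' R) := by
    simpa using ker_le_comap (QuotientGroup.mk' R) S
  have hi : (S.comap (QuotientGroup.mk' R)).index = q := by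
    rw [index_comap_of_surjective _ (QuotientGroup.mk'_surjective R)]
    have := S.card_mul_index
    rw [hc, ← Subgroup.index, hR] at this
    exact Nat.eq_of_mul_eq_mul_left hp.pos this
  have hr : R.relIndex (S.comap (QuotientGroup.mk' R)) = p := by
    have := relIndex_mul_index hle
    rw [hi, hR] at this
    exact Nat.eq_of_mul_eq_mul_right hq this
  exact ⟨_, hS.comap _, hle, hi, hr, commutator_le_of_relIndex_prime (hr ▸ hp)⟩

theorem card_prime_of_eq_bot_or_eq_top [Finite G] [Nontrivial G]
    (h : ∀ H : Subgroup G, H = ⊥ ∨ H = ⊤) : (Nat.card G).Prime := by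
  obtain ⟨p, hp, hd⟩ := Nat.exists_prime_and_dvd (Finite.one_lt_card (α := G)).ne'
  have := Fact.mk hp
  obtain ⟨x, hx⟩ := exists_prime_orderOf_dvd_card' p hd
  have : zpowers x = ⊤ := (h _).resolve_left fun hb => by
    rw [zpowers_eq_bot] at hb
    rw [hb, orderOf_one] at hx
    exact hp.one_lt.ne hx
  rw [← Nat.card_congr (topEquiv (G := G)).toEquiv, ← this, Nat.card_zpowers, hx]
  exact hp

theorem Subgroup.card_prime_of_forall_le [Finite G] {N : Subgroup G} (hN : N ≠ ⊥)
    (h : ∀ H ≤ N, H = ⊥ ∨ H = N) : (Nat.card N).Prime := by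
  have := (nontrivial_iff_ne_bot N).2 hN
  refine card_prime_of_eq_bot_or_eq_top fun H => ?_
  rcases h _ (map_subtype_le H) with h | h
  · exact Or.inl ((map_eq_bot_iff_of_injective _ N.subtype_injective).1 h)
  · refine Or.inr (map_injective N.subtype_injective ?_)
    rw [h, ← MonoidHom.range_eq_map, N.range_subtype]

theorem ker_conjNormal_eq_centralizer (N : Subgroup G) [N.Normal] :
    (MulAut.conjNormal (H := N)).ker = centralizer (N : Set G) := by
  ext g
  rw [MonoidHom.mem_ker, mem_centralizer_iff, MulEquiv.ext_iff]
  constructor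
  · intro h n hn
    have := congr_arg Subtype.val (h ⟨n, hn⟩)
    rw [MulAut.conjNormal_apply] at this
    exact (mul_inv_eq_iff_eq_mul.1 this).symm
  · intro h n
    apply Subtype.ext
    rw [MulAut.conjNormal_apply]
    exact mul_inv_eq_iff_eq_mul.2 (h n n.2).symm

theorem Subgroup.index_centralizer_dvd [Finite G] {N : Subgroup G} [N.Normal] {p : ℕ}
    (hp : p.Prime) (hN : Nat.card N = p) : (centralizer (N : Set G)).index ∣ p - 1 := by
  have := Fact.mk hp
  have : IsCyclic N := isCyclic_of_prime_card hN
  rw [← ker_conjNormal_eq_centralizer, index_ker]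
  refine (card_subgroup_dvd_card _).trans ?_
  rw [Nat.card_congr (IsCyclic.mulAutMulEquiv N).toEquiv, hN, Nat.card_eq_fintype_card,
    ZMod.card_units]

theorem isPrimeMulSmaller_card [Finite G] {N : Subgroup G} [N.Normal] (hN : (Nat.card N).Prime)
    (hC : centralizer (N : Set G) ≤ N) (hi : N.index = 1 ∨ N.index.Prime) :
    IsPrimeMulSmaller (Nat.card G) := by
  refine ⟨_, _, hN, hi, ?_, N.card_mul_index.symm⟩
  have h1 := (index_dvd_of_le hC).trans (index_centralizer_dvd hN rfl)
  have := Nat.le_of_dvd (Nat.sub_pos_of_lt hN.one_lt) h1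
  have := hN.two_le
  omega

theorem IsPGroup.normal_of_isCoatom [Finite G] {p : ℕ} [Fact p.Prime] (hG : IsPGroup p G)
    {M : Subgroup G} (hM : IsCoatom M) : M.Normal := by
  have := hG.isNilpotent
  exact Group.normalizerCondition_of_isNilpotent.normal_of_coatom _ hM

theorem card_prime_of_isCoatom_bot [Finite G] (h : IsCoatom (⊥ : Subgroup G)) :
    (Nat.card G).Prime := by
  have : Nontrivial G := by
    have := nontrivial_of_ne _ _ h.1
    exact (nontrivial_iff (G := G)).1 this
  exact card_prime_of_eq_bot_or_eq_top fun H =>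
    (eq_or_ne H ⊥).imp id fun hH => h.2 H (bot_lt_iff_ne_bot.2 hH)

theorem Subgroup.eq_bot_of_le_normalizer {M N D : Subgroup G} (hM : M.normalCore = ⊥)
    (hD : D ≤ M) (h : N ⊔ M = ⊤) (h1 : N ≤ normalizer (D : Set G))
    (h2 : M ≤ normalizer (D : Set G)) : D = ⊥ := by
  have : D.Normal := normalizer_eq_top_iff.1 (top_le_iff.1 (h ▸ sup_le h1 h2))
  exact le_bot_iff.1 (hM ▸ normal_le_normalCore.2 hD)

theorem Subgroup.not_le_of_normalCore_eq_bot {M N : Subgroup G} [N.Normal]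
    (hM : M.normalCore = ⊥) (hN : N ≠ ⊥) : ¬ N ≤ M :=
  fun hle => hN (le_bot_iff.1 (hM ▸ normal_le_normalCore.2 hle))

theorem IsCoatom.sup_eq_top_of_not_le {M N : Subgroup G} (hM : IsCoatom M) (h : ¬ N ≤ M) :
    N ⊔ M = ⊤ :=
  hM.2 _ (lt_of_le_of_ne le_sup_right fun he => h (he ▸ le_sup_left))

/-- The structure of a primitive group with an abelian normal subgroup. -/
theorem IsCoatom.complement_of_normalCore_eq_bot {M N : Subgroup G} [N.Normal] (hM : IsCoatom M)
    (hc : M.normalCore = ⊥) (hN : N ≠ ⊥) (hab : N ≤ centralizer (N : Set G)) :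
    N ⊓ M = ⊥ ∧ N ⊔ M = ⊤ ∧ centralizer (N : Set G) = N := by
  have hsup := hM.sup_eq_top_of_not_le (not_le_of_normalCore_eq_bot hc hN)
  have key : ∀ D : Subgroup G, D.Normal → D ≤ centralizer (N : Set G) → D ⊓ M = ⊥ := by
    intro D hD hDN
    refine eq_bot_of_le_normalizer hc inf_le_right hsup ?_ ?_
    · rw [le_normalizer_iff]
      intro n hn d hd
      rw [mem_centralizer_iff.1 (hDN hd.1) n hn, mul_inv_cancel_right]
      exact hd
    · rw [le_normalizer_iff]
      exact fun m hm d hd =>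
        ⟨hD.conj_mem d hd.1 m, M.mul_mem (M.mul_mem hm hd.2) (M.inv_mem hm)⟩
  refine ⟨key N ‹_› hab, hsup, le_antisymm (fun c hc' => ?_) hab⟩
  obtain ⟨n, hn, m, hm, rfl⟩ := mem_sup_of_normal_left.1 (hsup ▸ mem_top c)
  have h1 : m ∈ centralizer (N : Set G) := by
    simpa using mul_mem (inv_mem (hab hn)) hc'
  have h2 : m ∈ centralizer (N : Set G) ⊓ M := ⟨h1, hm⟩
  rw [key _ inferInstance le_rfl, mem_bot] at h2
  rwa [h2, mul_one]

theorem mul_comm_of_conj_mem {M N : Subgroup G} [N.Normal] (h : N ⊓ M = ⊥) {n m : G}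
    (hn : n ∈ N) (hm : m ∈ M) (hc : n * m * n⁻¹ ∈ M) : n * m = m * n := by
  have : n * m * n⁻¹ * m⁻¹ ∈ N ⊓ M :=
    ⟨by
      have := N.mul_mem hn (‹N.Normal›.conj_mem _ (N.inv_mem hn) m)
      simpa [mul_assoc] using this, M.mul_mem hc (M.inv_mem hm)⟩
  rw [h, mem_bot] at this
  exact commutatorElement_eq_one_iff_mul_comm.1 this

theorem Subgroup.le_center_of_squarefree_card [Finite G] {p : ℕ} (hp : p.Prime)
    (hmin : ∀ q : ℕ, q.Prime → q ∣ Nat.card G → p ≤ q) (hsq : Squarefree (Nat.card G))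
    {P : Subgroup G} [P.Normal] (hP : IsPGroup p P) : P ≤ center G := by
  have := Fact.mk hp
  obtain ⟨k, hk⟩ := IsPGroup.iff_card.1 hP
  have hk1 : k ≤ 1 := by
    by_contra! h
    have h1 : p * p ∣ Nat.card G := by
      rw [← pow_two]
      exact (pow_dvd_pow p h).trans (hk ▸ P.card_subgroup_dvd_card)
    exact hp.not_isUnit (hsq p h1)
  rcases Nat.le_one_iff_eq_zero_or_eq_one.1 hk1 with rfl | rfl
  · rw [pow_zero, card_eq_one] at hk
    exact hk ▸ bot_le
  · rw [pow_one] at hk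
    have h1 := index_centralizer_dvd hp hk
    have h2 : (centralizer (P : Set G)).index = 1 := by
      by_contra h
      obtain ⟨q, hq, hqd⟩ := Nat.exists_prime_and_dvd h
      have h3 := hmin q hq (hqd.trans (index_dvd_card _))
      have h4 := Nat.le_of_dvd (Nat.sub_pos_of_lt hp.one_lt) (hqd.trans h1)
      have := hp.two_le
      omega
    rw [index_eq_one] at h2
    intro x hx
    rw [mem_center_iff]
    intro g
    exact (mem_centralizer_iff.1 (h2 ▸ mem_top g : g ∈ centralizer (P : Set G)) x hx).symm

theorem commutator_mem_of_squarefree_index [Finite G] {p : ℕ} (hp : p.Prime)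
    (hmin : ∀ q : ℕ, q.Prime → q ∣ Nat.card G → p ≤ q) {R : Subgroup G} [R.Normal]
    (hsq : Squarefree R.index) {P : Subgroup G} [P.Normal] (hP : IsPGroup p P) {a : G}
    (ha : a ∈ P) (b : G) : ⁅a, b⁆ ∈ R := by
  have hn : (P.map (QuotientGroup.mk' R)).Normal :=
    ‹P.Normal›.map _ (QuotientGroup.mk'_surjective R)
  have h := le_center_of_squarefree_card (G := G ⧸ R) hp
    (fun q hq hd => hmin q hq (hd.trans (index_dvd_card R))) hsq
    (hP.map (QuotientGroup.mk' R)) (mem_map_of_mem _ ha)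
  have h1 := mem_center_iff.1 h (QuotientGroup.mk' R b)
  rw [← QuotientGroup.ker_mk' R, MonoidHom.mem_ker, map_commutatorElement]
  exact commutatorElement_eq_one_iff_mul_comm.2 h1.symm

/-- Burnside's transfer theorem for simple groups. -/
theorem Sylow.not_normalizer_le_centralizer [Finite G] {p : ℕ} [hp : Fact p.Prime]
    (hG : ∀ N : Subgroup G, N.Normal → N = ⊥ ∨ N = ⊤) (hd : p ∣ Nat.card G)
    (hpG : ¬ IsPGroup p G) (P : Sylow p G) :
    ¬ normalizer ((P : Subgroup G) : Set G) ≤ centralizer ((P : Subgroup G) : Set G) := by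
  intro h
  have hc := MonoidHom.ker_transferSylow_isComplement' P h
  rcases hG _ (MonoidHom.normal_ker (MonoidHom.transferSylow P h)) with h1 | h1
  · rw [h1, isComplement'_bot_left] at hc
    exact hpG (IsPGroup.of_equiv (hc ▸ P.isPGroup') topEquiv)
  · rw [h1, isComplement'_top_left] at hc
    have := P.dvd_card_of_dvd_card hd
    rw [hc, card_bot] at this
    exact hp.out.one_lt.ne' (Nat.dvd_one.1 this)

theorem IsPrimeMulSmaller.exists_normal_between [Finite G] {R : Subgroup G} [R.Normal]
    (h : IsPrimeMulSmaller R.index) : ∃ (p q : ℕ) (S : Subgroup G), p.Prime ∧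
      (q = 1 ∨ q.Prime) ∧ q < p ∧ S.Normal ∧ R ≤ S ∧ S.index = q ∧ R.relIndex S = p ∧
      ⁅S, S⁆ ≤ R ∧ _root_.commutator G ≤ S := by
  obtain ⟨p, q, hp, hq, hqp, hR⟩ := h
  have hq0 : 0 < q := by
    rcases hq with rfl | hq
    exacts [one_pos, hq.pos]
  obtain ⟨S, hS, hRS, hi, hr, hc⟩ := exists_normal_between_of_index_eq hp hq0 hqp hR
  refine ⟨p, q, S, hp, hq, hqp, hS, hRS, hi, hr, hc, ?_⟩
  rcases hq with rfl | hq
  · exact index_eq_one.1 hi ▸ le_top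
  · exact commutator_le_of_relIndex_prime (by rwa [relIndex_top_right, hi])

theorem IsPrimeMulSmaller.commutator_ne_top [Finite G] {R : Subgroup G} [R.Normal]
    (h : IsPrimeMulSmaller R.index) : _root_.commutator G ≠ ⊤ := by
  obtain ⟨p, q, S, hp, hq, hqp, hS, hRS, hi, hr, hc, hcS⟩ := h.exists_normal_between
  intro ht
  have hS1 : S = ⊤ := top_le_iff.1 (ht ▸ hcS)
  have hR1 : R = ⊤ := top_le_iff.1 (by
    rw [hS1, ← _root_.commutator_def, ht] at hc
    exact hc)
  rw [hR1, relIndex_top_left] at hr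
  exact hp.one_lt.ne hr

theorem exists_minimal_normal [Finite G] {K : Subgroup G} (hK : K.Normal) (hb : K ≠ ⊥) :
    ∃ N : Subgroup G, N.Normal ∧ N ≠ ⊥ ∧ N ≤ K ∧
      ∀ L : Subgroup G, L.Normal → L ≤ N → L = ⊥ ∨ L = N := by
  obtain ⟨N, hNK, hN⟩ := (Set.toFinite {L : Subgroup G | L.Normal ∧ L ≠ ⊥}).exists_le_minimal
    (show K ∈ {L : Subgroup G | L.Normal ∧ L ≠ ⊥} from ⟨hK, hb⟩)
  refine ⟨N, hN.prop.1, hN.prop.2, hNK, fun L hL hLN => ?_⟩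
  by_cases h : L = ⊥
  · exact Or.inl h
  · exact Or.inr (hN.eq_of_le ⟨hL, h⟩ hLN)

theorem Subgroup.le_centralizer_self_of_minimal {N : Subgroup G} (hN : N.Normal)
    (hmin : ∀ L : Subgroup G, L.Normal → L ≤ N → L = ⊥ ∨ L = N) (h : _root_.commutator N ≠ ⊤) :
    N ≤ centralizer (N : Set G) := by
  rw [← commutator_eq_bot_iff_le_centralizer]
  refine (hmin _ inferInstance (commutator_le_self N)).resolve_right fun he => h ?_
  apply map_injective N.subtype_injective
  rw [map_subtype_commutator, he, ← MonoidHom.range_eq_map, range_subtype]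

theorem IsCoatomModular.comap_conj {M : Subgroup G} (h : IsCoatomModular M) (g : G) :
    IsCoatomModular (M.comap (MulAut.conj g).toMonoidHom) :=
  h.comap (MulAut.conj g).injective

theorem card_eq_one_or_prime_of_forall_le [Finite G] {M : Subgroup G}
    (h : ∀ X ≤ M, X = ⊥ ∨ X = M) : Nat.card M = 1 ∨ (Nat.card M).Prime := by
  by_cases hM : M = ⊥
  · exact Or.inl (card_eq_one.2 hM)
  · exact Or.inr (card_prime_of_forall_le hM h)

theorem Subgroup.index_eq_card_of_complement {M N : Subgroup G} [N.Normal] (h : N ⊓ M = ⊥)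
    (h' : N ⊔ M = ⊤) : N.index = Nat.card M := by
  rw [← relIndex_top_right, ← h', sup_comm, relIndex_sup_right, ← inf_relIndex_right, h,
    relIndex_bot_left]

theorem IsCoatomModular.isPrimeMulSmaller_of_abelian [Finite G] {M N : Subgroup G} [N.Normal]
    (h : IsCoatomModular M) (hM : M ≠ ⊤) (hc : M.normalCore = ⊥) (hN : N ≠ ⊥)
    (hab : N ≤ centralizer (N : Set G)) : IsPrimeMulSmaller (Nat.card G) := by
  obtain ⟨hinf, hsup, hC⟩ := (h.isCoatom hM).complement_of_normalCore_eq_bot hc hN hab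
  have hX : ∀ X ≤ N, X = ⊥ ∨ X = N := by
    intro X hXN
    by_cases hXM : X ≤ M
    · exact Or.inl (le_bot_iff.1 (hinf ▸ le_inf hXN hXM))
    · have := h X N hXN hXM
      rw [inf_comm, hinf, sup_bot_eq] at this
      exact Or.inr this
  refine isPrimeMulSmaller_card (N := N) (card_prime_of_forall_le hN hX) hC.le ?_
  rw [index_eq_card_of_complement hinf hsup]
  obtain ⟨n, hnN, hn⟩ := (bot_or_exists_ne_one N).resolve_left hN
  have hzN : zpowers n = N :=
    (hX _ (zpowers_le.2 hnN)).resolve_left fun hb => hn (zpowers_eq_bot.1 hb)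
  have hint : M.comap (MulAut.conj n).toMonoidHom ⊓ M = ⊥ := by
    rw [eq_bot_iff, ← hinf]
    rintro m ⟨hm', hm⟩
    refine ⟨show m ∈ N from ?_, hm⟩
    rw [← hC, ← hzN, mem_centralizer_iff]
    rintro _ ⟨k, rfl⟩
    have : Commute n m := mul_comm_of_conj_mem hinf hnN hm hm'
    exact (this.zpow_left k).eq
  refine card_eq_one_or_prime_of_forall_le fun X hXM => ?_
  by_cases hXM' : X ≤ M.comap (MulAut.conj n).toMonoidHom
  · exact Or.inl (le_bot_iff.1 (hint ▸ le_inf hXM' hXM))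
  · have := h.comap_conj n X M hXM hXM'
    rw [hint, sup_bot_eq] at this
    exact Or.inr this

theorem normalCore_eq_bot_of_simple {M : Subgroup G}
    (hG : ∀ N : Subgroup G, N.Normal → N = ⊥ ∨ N = ⊤) (hM : M ≠ ⊤) : M.normalCore = ⊥ :=
  (hG _ inferInstance).resolve_right fun h => hM (top_le_iff.1 (h ▸ M.normalCore_le))

theorem IsPGroup.card_prime_of_simple [Finite G] {p : ℕ} [Fact p.Prime] (hp : IsPGroup p G)
    (hG : ∀ N : Subgroup G, N.Normal → N = ⊥ ∨ N = ⊤) {M : Subgroup G} (hM : IsCoatom M) :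
    (Nat.card G).Prime := by
  have h1 := (hG M (hp.normal_of_isCoatom hM)).resolve_right hM.1
  exact card_prime_of_isCoatom_bot (h1 ▸ hM)

theorem Subgroup.card_lt_of_ne_top [Finite G] {H : Subgroup G} (h : H ≠ ⊤) :
    Nat.card H < Nat.card G :=
  lt_of_le_of_ne H.card_le_card_group fun he => h (card_eq_iff_eq_top H |>.1 he)

theorem Subgroup.index_lt_card_of_ne_bot [Finite G] {H : Subgroup G} (h : H ≠ ⊥) :
    H.index < Nat.card G := by
  rw [← H.card_mul_index]
  have h1 := (one_lt_card_iff_ne_bot H).2 h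
  have h2 : 0 < H.index := Nat.pos_of_ne_zero index_ne_zero_of_finite
  nlinarith

theorem IsPGroup.eq_top_of_sylow_eq_top {p : ℕ} {P : Sylow p G} (h : (P : Subgroup G) = ⊤) :
    IsPGroup p G :=
  IsPGroup.of_equiv (h ▸ P.isPGroup') topEquiv

theorem IsCoatomModular.isPGroup_of_simple [Finite G] {M : Subgroup G} (h : IsCoatomModular M)
    (hM : M ≠ ⊤) (hG : ∀ N : Subgroup G, N.Normal → N = ⊥ ∨ N = ⊤)
    (ih : ∀ H : Subgroup G, H ≠ ⊤ → ∀ L : Subgroup H, IsCoatomModular L → L ≠ ⊤ →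
      IsPrimeMulSmaller L.normalCore.index) : IsPGroup (Nat.card G).minFac G := by
  set p := (Nat.card G).minFac with hpdef
  have : Nontrivial (Subgroup G) := ⟨M, ⊤, hM⟩
  have hGn : Nontrivial G := nontrivial_iff.1 this
  have hp : p.Prime := Nat.minFac_prime Finite.one_lt_card.ne'
  have := Fact.mk hp
  by_contra hpG
  obtain ⟨P⟩ : Nonempty (Sylow p G) := inferInstance
  have hd : p ∣ Nat.card G := Nat.minFac_dvd _
  apply P.not_normalizer_le_centralizer hG hd hpG
  set H := normalizer ((P : Subgroup G) : Set G) with hH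
  have hHtop : H ≠ ⊤ := by
    intro ht
    rcases hG _ (normalizer_eq_top_iff.1 ht) with h1 | h1
    · have := P.dvd_card_of_dvd_card hd
      rw [h1, card_bot] at this
      exact hp.one_lt.ne' (Nat.dvd_one.1 this)
    · exact hpG (IsPGroup.eq_top_of_sylow_eq_top h1)
  have key : ∀ L : Subgroup G, IsCoatomModular L → ∀ a ∈ (P : Subgroup G), ∀ b ∈ H,
      ⁅a, b⁆ ∈ L := by
    intro L hL a ha b hb
    by_cases hHL : H ≤ L
    · exact L.mul_mem (L.mul_mem (L.mul_mem (hHL (le_normalizer ha)) (hHL hb))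
        (L.inv_mem (hHL (le_normalizer ha)))) (L.inv_mem (hHL hb))
    · have h1 := ih H hHtop (L.subgroupOf H) (hL.comap H.subtype_injective)
        (fun h => hHL (subgroupOf_eq_top.1 h))
      have h2 := commutator_mem_of_squarefree_index (G := H) hp
        (fun q hq hqd => Nat.minFac_le_of_dvd hq.two_le (hqd.trans H.card_subgroup_dvd_card))
        h1.squarefree (P := (P : Subgroup G).subgroupOf H)
        (P.isPGroup'.comap_of_injective _ H.subtype_injective)
        (a := ⟨a, le_normalizer ha⟩) ha ⟨b, hb⟩
      exact mem_subgroupOf.1 (normalCore_le (L.subgroupOf H) h2)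
  intro b hb
  rw [mem_centralizer_iff]
  intro a ha
  have h1 : ⁅a, b⁆ ∈ M.normalCore := fun g => key _ (h.comap_conj g) a ha b hb
  rw [normalCore_eq_bot_of_simple hG hM, mem_bot] at h1
  exact commutatorElement_eq_one_iff_mul_comm.1 h1

theorem Subgroup.index_normalCore_comap {H : Type*} [Group H] {f : G →* H}
    (hf : Function.Surjective f) (M : Subgroup H) :
    (M.comap f).normalCore.index = M.normalCore.index := by
  rw [← index_comap_of_surjective _ hf]
  congr 1
  ext g
  refine (forall_congr' fun x => ?_).trans (hf.forall (p := fun y => y * f g * y⁻¹ ∈ M)).symm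
  simp

theorem Subgroup.normalCore_map_normalCore (M : Subgroup G) :
    (M.map (QuotientGroup.mk' M.normalCore)).normalCore = ⊥ := by
  rw [eq_bot_iff]
  intro x hx
  obtain ⟨g, rfl⟩ := QuotientGroup.mk'_surjective _ x
  rw [mem_bot, ← MonoidHom.mem_ker, QuotientGroup.ker_mk']
  intro b
  have h1 := hx (QuotientGroup.mk' _ b)
  rw [← map_mul, ← map_inv, ← map_mul] at h1
  have h2 : b * g * b⁻¹ ∈ (M.map (QuotientGroup.mk' M.normalCore)).comap
    (QuotientGroup.mk' M.normalCore) := h1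
  rwa [comap_map_eq_self (by rw [QuotientGroup.ker_mk']; exact M.normalCore_le)] at h2

theorem IsCoatomModular.map_mk {M R : Subgroup G} [R.Normal] (h : IsCoatomModular M)
    (hR : R ≤ M) : IsCoatomModular (M.map (QuotientGroup.mk' R)) := by
  refine IsCoatomModular.of_comap (QuotientGroup.mk'_surjective R) ?_
  rwa [comap_map_eq_self (by rwa [QuotientGroup.ker_mk'])]

theorem Subgroup.map_mk_ne_top {M R : Subgroup G} [R.Normal] (hM : M ≠ ⊤) (hR : R ≤ M) :
    M.map (QuotientGroup.mk' R) ≠ ⊤ := by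
  intro h
  apply hM
  rw [← comap_map_eq_self (H := M) (f := QuotientGroup.mk' R) (by rwa [QuotientGroup.ker_mk']), h,
    comap_top]

theorem IsCoatomModular.isPrimeMulSmaller [Finite G] {M : Subgroup G} (h : IsCoatomModular M)
    (hM : M ≠ ⊤) : IsPrimeMulSmaller M.normalCore.index := by
  induction hn : Nat.card G using Nat.strong_induction_on generalizing G with
  | _ n ih =>
  subst hn
  by_cases hc : M.normalCore = ⊥
  · rw [hc, index_bot]
    have ih' : ∀ H : Subgroup G, H ≠ ⊤ → ∀ L : Subgroup H, IsCoatomModular L → L ≠ ⊤ →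
      IsPrimeMulSmaller L.normalCore.index :=
        fun H hH L hL hLt => ih _ (card_lt_of_ne_top hH) hL hLt rfl
    by_cases hG : ∀ N : Subgroup G, N.Normal → N = ⊥ ∨ N = ⊤
    · have : Nontrivial (Subgroup G) := ⟨M, ⊤, hM⟩
      have hGn : Nontrivial G := nontrivial_iff.1 this
      have := Fact.mk (Nat.minFac_prime (Finite.one_lt_card (α := G)).ne')
      exact ((h.isPGroup_of_simple hM hG ih').card_prime_of_simple hG
        (h.isCoatom hM)).isPrimeMulSmaller
    · push Not at hG
      obtain ⟨K, hK, hKb, hKt⟩ := hG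
      obtain ⟨N, hN, hNb, hNK, hmin⟩ := exists_minimal_normal hK hKb
      have hNt : N ≠ ⊤ := fun hNt => hKt (top_le_iff.1 (hNt ▸ hNK))
      refine h.isPrimeMulSmaller_of_abelian hM hc hNb (le_centralizer_self_of_minimal hN hmin ?_)
      exact (ih' N hNt (M.subgroupOf N) (h.comap N.subtype_injective)
        (fun ht => not_le_of_normalCore_eq_bot hc hNb (subgroupOf_eq_top.1 ht))).commutator_ne_top
  · have h1 := ih _ (index_lt_card_of_ne_bot hc) (h.map_mk M.normalCore_le)
      (map_mk_ne_top hM M.normalCore_le) rfl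
    rw [normalCore_map_normalCore, index_bot] at h1
    exact h1

theorem Subgroup.mem_sup_of_mul_comm {H K : Subgroup G}
    (h : (H : Set G) * (K : Set G) = (K : Set G) * (H : Set G)) {x : G} :
    x ∈ H ⊔ K ↔ x ∈ (H : Set G) * (K : Set G) := by
  constructor
  · let L : Subgroup G :=
      { carrier := (H : Set G) * (K : Set G)
        mul_mem' := by
          rintro _ _ ⟨a, ha, b, hb, rfl⟩ ⟨c, hc, d, hd, rfl⟩
          have h1 : b * c ∈ (H : Set G) * (K : Set G) := h ▸ Set.mul_mem_mul hb hc
          obtain ⟨e, he, f, hf, hef⟩ := h1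
          refine ⟨a * e, H.mul_mem ha he, f * d, K.mul_mem hf hd, ?_⟩
          simp only at hef ⊢
          rw [mul_assoc, ← mul_assoc e, hef]
          simp only [mul_assoc]
        one_mem' := ⟨1, H.one_mem, 1, K.one_mem, mul_one 1⟩
        inv_mem' := by
          rintro _ ⟨a, ha, b, hb, rfl⟩
          rw [h]
          exact ⟨b⁻¹, K.inv_mem hb, a⁻¹, H.inv_mem ha, (mul_inv_rev a b).symm⟩ }
    have hL : H ⊔ K ≤ L := sup_le (fun a ha => ⟨a, ha, 1, K.one_mem, mul_one a⟩)
      (fun b hb => ⟨1, H.one_mem, b, hb, one_mul b⟩)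
    exact fun hx => hL hx
  · rintro ⟨a, ha, b, hb, rfl⟩
    exact mul_mem (mem_sup_left ha) (mem_sup_right hb)

theorem Subgroup.relIndex_sup_of_mul_comm {H K : Subgroup G}
    (h : (H : Set G) * (K : Set G) = (K : Set G) * (H : Set G)) :
    H.relIndex (H ⊔ K) = H.relIndex K := by
  refine (Nat.card_congr (Equiv.ofBijective
    (quotientSubgroupOfEmbeddingOfLE H (le_sup_right : K ≤ H ⊔ K))
    ⟨Function.Embedding.injective _, fun x => ?_⟩)).symm
  obtain ⟨⟨x, hx⟩, rfl⟩ := QuotientGroup.mk_surjective x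
  have hx' := (mem_sup_of_mul_comm h).1 hx
  rw [h] at hx'
  obtain ⟨k, hk, a, ha, rfl⟩ := hx'
  refine ⟨QuotientGroup.mk ⟨k, hk⟩, ?_⟩
  rw [quotientSubgroupOfEmbeddingOfLE_apply_mk, QuotientGroup.eq, mem_subgroupOf]
  simpa using ha

theorem IsPGroup.of_forall_prime_dvd [Finite G] {p : ℕ}
    (h : ∀ q : ℕ, q.Prime → q ∣ Nat.card G → q = p) : IsPGroup p G :=
  IsPGroup.of_card (Nat.eq_prime_pow_of_unique_prime_dvd Nat.card_pos.ne' fun hq hd => h _ hq hd)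

theorem isPGroup_zpowers {p k : ℕ} {x : G} (h : x ^ p ^ k = 1) : IsPGroup p (zpowers x) := by
  rintro ⟨_, i, rfl⟩
  refine ⟨k, Subtype.ext ?_⟩
  change (x ^ i) ^ p ^ k = 1
  rw [← zpow_natCast, zpow_comm, zpow_natCast, h, one_zpow]

theorem IsSQuasinormal.mem_of_pow_eq_one [Finite G] {T : Subgroup G} (hT : IsSQuasinormal T)
    {p k : ℕ} (hp : p.Prime) (hi : T.index = p ^ k) {q l : ℕ} (hq : q.Prime) (hqp : q ≠ p)
    {x : G} (hx : x ^ q ^ l = 1) : x ∈ T := by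
  have := Fact.mk hq
  obtain ⟨Q, hQ⟩ := (isPGroup_zpowers hx).exists_le_sylow
  obtain ⟨a, ha⟩ := IsPGroup.iff_card.1 Q.isPGroup'
  have h1 : T.relIndex Q ∣ q ^ a := ha ▸ T.relIndex_dvd_card _
  have h2 : T.relIndex Q ∣ p ^ k := by
    rw [← relIndex_sup_of_mul_comm (hT q hq Q), ← hi]
    exact relIndex_dvd_index_of_le le_sup_left
  have h3 : Nat.Coprime (q ^ a) (p ^ k) :=
    Nat.Coprime.pow _ _ ((Nat.coprime_primes hq hp).2 hqp)
  exact relIndex_eq_one.1 (Nat.eq_one_of_dvd_coprimes h3 h1 h2) (hQ (mem_zpowers x))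

theorem IsSQuasinormal.subgroupOf [Finite G] {T H : Subgroup G} (hT : IsSQuasinormal T)
    (hTH : T ≤ H) : IsSQuasinormal (T.subgroupOf H) := by
  intro p hp P
  have := Fact.mk hp
  obtain ⟨P', hP'⟩ := (P.isPGroup'.map H.subtype).exists_le_sylow
  have hPP : (P' : Subgroup G).subgroupOf H = P :=
    P.is_maximal' (P'.isPGroup'.comap_of_injective _ H.subtype_injective)
      (map_le_iff_le_comap.1 hP')
  have hmem : ∀ x (hx : x ∈ H), x ∈ (P' : Subgroup G) → (⟨x, hx⟩ : H) ∈ (P : Subgroup H) :=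
    fun x hx h => hPP ▸ h
  have hmem' : ∀ x : H, x ∈ (P : Subgroup H) → (x : G) ∈ (P' : Subgroup G) :=
    fun x hx => hP' (mem_map_of_mem _ hx)
  have h := hT p hp P'
  ext y
  constructor
  · rintro ⟨t, ht, x, hx, rfl⟩
    have h1 : (t : G) * x ∈ ((P' : Subgroup G) : Set G) * (T : Set G) :=
      h ▸ Set.mul_mem_mul ht (hmem' x hx)
    obtain ⟨z, hz, s, hs, he⟩ := h1
    have hzH : z ∈ H := by
      rw [eq_mul_inv_of_mul_eq he]
      exact H.mul_mem (H.mul_mem t.2 x.2) (H.inv_mem (hTH hs))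
    exact ⟨⟨z, hzH⟩, hmem z hzH hz, ⟨s, hTH hs⟩, hs, Subtype.ext he⟩
  · rintro ⟨x, hx, t, ht, rfl⟩
    have h1 : (x : G) * t ∈ (T : Set G) * ((P' : Subgroup G) : Set G) :=
      h ▸ Set.mul_mem_mul (hmem' x hx) ht
    obtain ⟨s, hs, z, hz, he⟩ := h1
    have hzH : z ∈ H := by
      rw [eq_inv_mul_of_mul_eq he]
      exact H.mul_mem (H.inv_mem (hTH hs)) (H.mul_mem x.2 t.2)
    exact ⟨⟨s, hTH hs⟩, hs, ⟨z, hzH⟩, hmem z hzH hz, Subtype.ext he⟩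

theorem IsSQuasinormal.map [Finite G] {H : Type*} [Group H] {T : Subgroup G}
    (hT : IsSQuasinormal T) {f : G →* H} (hf : Function.Surjective f) :
    IsSQuasinormal (T.map f) := by
  intro p hp P
  have := Fact.mk hp
  obtain ⟨Q, rfl⟩ := Sylow.mapSurjective_surjective hf p P
  have h := congr_arg (fun s => f '' s) (hT p hp Q)
  simpa only [Set.image_mul, Sylow.coe_mapSurjective, coe_map] using h

/-- The subgroup of `T` generated by its elements of prime power order coprime to `p`. -/
def Subgroup.pResidual (p : ℕ) (T : Subgroup G) : Subgroup G :=
  closure {x | x ∈ T ∧ ∃ q : ℕ, q.Prime ∧ q ≠ p ∧ ∃ k : ℕ, x ^ q ^ k = 1}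

theorem Subgroup.pResidual_le (p : ℕ) (T : Subgroup G) : T.pResidual p ≤ T :=
  (closure_le _).2 fun _ hx => hx.1

theorem Subgroup.mem_pResidual {p q k : ℕ} {T : Subgroup G} {x : G} (hx : x ∈ T) (hq : q.Prime)
    (hqp : q ≠ p) (h : x ^ q ^ k = 1) : x ∈ T.pResidual p :=
  subset_closure ⟨hx, q, hq, hqp, k, h⟩

theorem Subgroup.isPGroup_of_pResidual_eq_bot [Finite G] {p : ℕ} {T : Subgroup G}
    (h : T.pResidual p = ⊥) : IsPGroup p T := by
  refine IsPGroup.of_forall_prime_dvd fun q hq hd => ?_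
  by_contra hqp
  have := Fact.mk hq
  obtain ⟨x, hx⟩ := exists_prime_orderOf_dvd_card' q hd
  have h1 : (x : G) ^ q ^ 1 = 1 := by
    rw [pow_one, ← coe_pow, ← hx, pow_orderOf_eq_one, coe_one]
  have h2 := mem_pResidual x.2 hq hqp h1
  rw [h, mem_bot, OneMemClass.coe_eq_one] at h2
  rw [h2, orderOf_one] at hx
  exact hq.one_lt.ne hx

theorem Subgroup.normalizer_le_normalizer_pResidual (p : ℕ) (T : Subgroup G) :
    normalizer (T : Set G) ≤ normalizer (T.pResidual p : Set G) := by
  rw [le_normalizer_iff]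
  intro g hg
  have : T.pResidual p ≤ (T.pResidual p).comap (MulAut.conj g).toMonoidHom := by
    refine (closure_le _).2 ?_
    rintro x ⟨hx, q, hq, hqp, k, h⟩
    refine mem_pResidual (k := k) (((mem_normalizer_iff.1 hg) x).1 hx) hq hqp ?_
    change (g * x * g⁻¹) ^ q ^ k = 1
    rw [conj_pow, h, mul_one, mul_inv_cancel]
  exact fun x hx => this hx

instance Subgroup.pResidual_normal (p : ℕ) (T : Subgroup G) [T.Normal] :
    (T.pResidual p).Normal :=
  normalizer_eq_top_iff.1 (top_le_iff.1
    ((normalizer_eq_top (H := T)) ▸ T.normalizer_le_normalizer_pResidual p))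

theorem Subgroup.pResidual_mono (p : ℕ) {T H : Subgroup G} (h : T ≤ H) :
    T.pResidual p ≤ H.pResidual p :=
  closure_mono fun _ hx => ⟨h hx.1, hx.2⟩

theorem Subgroup.pResidual_eq_of_le {p : ℕ} {T H : Subgroup G} (hTH : T ≤ H)
    (h : ∀ x ∈ H, ∀ q k : ℕ, q.Prime → q ≠ p → x ^ q ^ k = 1 → x ∈ T) :
    T.pResidual p = H.pResidual p := by
  refine le_antisymm (pResidual_mono p hTH) (closure_mono ?_)
  rintro x ⟨hx, q, hq, hqp, k, hk⟩
  exact ⟨h x hx q k hq hqp hk, q, hq, hqp, k, hk⟩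

theorem IsPGroup.quotient_of_pResidual_le [Finite G] {p : ℕ} {R : Subgroup G} [R.Normal]
    (h : (⊤ : Subgroup G).pResidual p ≤ R) : IsPGroup p (G ⧸ R) := by
  refine IsPGroup.of_forall_prime_dvd fun q hq hd => ?_
  by_contra hqp
  have := Fact.mk hq
  obtain ⟨Q⟩ : Nonempty (Sylow q G) := inferInstance
  refine Q.not_dvd_index (hd.trans (index_dvd_of_le fun x hx => h ?_))
  obtain ⟨k, hk⟩ := Q.isPGroup' ⟨x, hx⟩
  exact mem_pResidual (mem_top x) hq hqp (congr_arg Subtype.val hk)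

theorem IsCoatom.map_mk {M R : Subgroup G} [R.Normal] (hM : IsCoatom M) (hR : R ≤ M) :
    IsCoatom (M.map (QuotientGroup.mk' R)) := by
  refine ⟨map_mk_ne_top hM.1 hR, fun X hX => ?_⟩
  have h1 : M < X.comap (QuotientGroup.mk' R) := by
    refine lt_of_le_of_ne (map_le_iff_le_comap.1 hX.le) fun he => hX.ne ?_
    rw [he, map_comap_eq_self_of_surjective (QuotientGroup.mk'_surjective R)]
  rw [← map_comap_eq_self_of_surjective (QuotientGroup.mk'_surjective R) X, hM.2 _ h1,
    map_top_of_surjective _ (QuotientGroup.mk'_surjective R)]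

theorem IsCoatom.index_prime_of_normal [Finite G] {M : Subgroup G} [M.Normal] (hM : IsCoatom M) :
    M.index.Prime := by
  have h := hM.map_mk le_rfl
  rw [QuotientGroup.map_mk'_self] at h
  exact card_prime_of_isCoatom_bot h

theorem IsSQuasinormal.isPrimeMulSmaller [Finite G] {M : Subgroup G} (h : IsSQuasinormal M)
    (hM : IsCoatom M) : IsPrimeMulSmaller M.normalCore.index := by
  suffices hn : M.Normal by
    rw [normalCore_eq_self]
    exact hM.index_prime_of_normal.isPrimeMulSmaller
  obtain ⟨q, hq, hqd⟩ := Nat.exists_prime_and_dvd (mt index_eq_one.1 hM.1)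
  have := Fact.mk hq
  obtain ⟨Q⟩ : Nonempty (Sylow q G) := inferInstance
  have hQ : ¬ (Q : Subgroup G) ≤ M := fun hle =>
    Q.not_dvd_index (hqd.trans (index_dvd_of_le hle))
  have hperm := h q hq Q
  have h1 := relIndex_sup_of_mul_comm hperm
  rw [sup_comm, hM.sup_eq_top_of_not_le hQ, relIndex_top_right] at h1
  obtain ⟨a, ha⟩ := IsPGroup.iff_card.1 Q.isPGroup'
  have h2 : M.index ∣ q ^ a := by
    rw [h1, ← ha]
    exact M.relIndex_dvd_card _
  obtain ⟨b, -, hb⟩ := (Nat.dvd_prime_pow hq).1 h2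
  have hle : (⊤ : Subgroup G).pResidual q ≤ M := by
    refine (closure_le _).2 ?_
    rintro x ⟨-, r, hr, hrq, k, hk⟩
    exact h.mem_of_pow_eq_one hq hb hr hrq hk
  have h3 := (IsPGroup.quotient_of_pResidual_le (le_refl _)).normal_of_isCoatom (hM.map_mk hle)
  rw [← comap_map_eq_self (H := M) (f := QuotientGroup.mk' ((⊤ : Subgroup G).pResidual q))
    (by rwa [QuotientGroup.ker_mk'])]
  exact h3.comap _

theorem HasSmallCoatomCores.of_isModular_or_isSQuasinormal [Finite G]
    (h : ∀ M : Subgroup G, IsCoatom M → IsModularSubgroup M ∨ IsSQuasinormal M) :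
    HasSmallCoatomCores G := by
  intro M hM
  rcases h M hM with h | h
  · exact (h.isCoatomModular hM).isPrimeMulSmaller hM.1
  · exact h.isPrimeMulSmaller hM

theorem isMaximalIn_iff_covBy {K H : Subgroup G} : IsMaximalIn K H ↔ H ⋖ K := by
  refine and_congr_right fun _ => ⟨fun h L hHL hLK => hLK.ne (h L hHL hLK.le),
    fun h L hHL hLK => ?_⟩
  exact hLK.eq_of_not_lt (h hHL)

theorem Subgroup.exists_covBy_of_lt [Finite G] {H K : Subgroup G} (h : H < K) :
    ∃ T, H ≤ T ∧ T ⋖ K := by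
  obtain ⟨T, hT, hmax⟩ := (Set.toFinite {T : Subgroup G | T < K}).exists_le_maximal
    (show H ∈ {T : Subgroup G | T < K} from h)
  exact ⟨T, hT, hmax.prop, fun L hTL hLK => hmax.not_gt hLK hTL⟩

theorem Subgroup.comap_covBy_comap {H : Type*} [Group H] {f : G →* H}
    (hf : Function.Surjective f) {T M : Subgroup H} (h : T ⋖ M) : T.comap f ⋖ M.comap f := by
  refine ⟨(comap_lt_comap_of_surjective hf).2 h.lt, fun X hTX hXM => ?_⟩
  have hX : (X.map f).comap f = X :=
    comap_map_eq_self ((f.ker_le_comap T).trans hTX.le)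
  rw [← hX, comap_lt_comap_of_surjective hf] at hTX hXM
  exact h.2 hTX hXM

theorem IsCoatom.map_subtype_covBy {M : Subgroup G} {T : Subgroup M} (hT : IsCoatom T) :
    T.map M.subtype ⋖ M := by
  have hlt : ∀ {A B : Subgroup M}, A.map M.subtype < B.map M.subtype ↔ A < B :=
    map_lt_map_iff_of_injective M.subtype_injective
  have hM : (⊤ : Subgroup M).map M.subtype = M := by
    rw [← MonoidHom.range_eq_map, range_subtype]
  refine ⟨?_, fun L hTL hLM => ?_⟩
  · conv_rhs => rw [← hM]
    exact hlt.2 hT.lt_top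
  · have hL : (L.subgroupOf M).map M.subtype = L := map_subgroupOf_eq_of_le hLM.le
    rw [← hL] at hTL hLM
    have h1 := hT.2 _ (hlt.1 hTL)
    rw [h1, hM] at hLM
    exact hLM.false

theorem IsModularSubgroup.comap {H : Type*} [Group H] {T : Subgroup G} (h : IsModularSubgroup T)
    {f : H →* G} (hf : Function.Injective f) (hT : T ≤ f.range) :
    IsModularSubgroup (T.comap f) := by
  constructor
  · intro X Z hXZ
    apply map_injective hf
    simp only [Subgroup.map_sup, Subgroup.map_inf _ _ f hf, map_comap_eq_self hT]
    exact h.1 _ _ (map_mono hXZ)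
  · intro Y Z hTZ
    apply map_injective hf
    simp only [Subgroup.map_sup, Subgroup.map_inf _ _ f hf, map_comap_eq_self hT]
    exact h.2 _ _ (by simpa only [map_comap_eq_self hT] using map_mono (f := f) hTZ)

theorem Subgroup.map_inf_comap' {H : Type*} [Group H] (f : G →* H) (A : Subgroup G)
    (Z : Subgroup H) : (A ⊓ Z.comap f).map f = A.map f ⊓ Z := by
  ext y
  constructor
  · rintro ⟨a, ⟨ha, hz⟩, rfl⟩
    exact ⟨⟨a, ha, rfl⟩, hz⟩
  · rintro ⟨⟨a, ha, rfl⟩, hz⟩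
    exact ⟨a, ⟨ha, hz⟩, rfl⟩

theorem IsModularSubgroup.map {H : Type*} [Group H] {T : Subgroup G} (h : IsModularSubgroup T)
    {f : G →* H} (hf : Function.Surjective f) : IsModularSubgroup (T.map f) := by
  constructor
  · intro X Z hXZ
    have h1 := congr_arg (Subgroup.map f) (h.1 _ _ (comap_mono (f := f) hXZ))
    simpa only [Subgroup.map_sup, map_inf_comap', map_comap_eq_self_of_surjective hf] using h1
  · intro Y Z hTZ
    have h1 := congr_arg (Subgroup.map f) (h.2 (Y.comap f) (Z.comap f) (map_le_iff_le_comap.1 hTZ))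
    simpa only [Subgroup.map_sup, map_inf_comap', map_comap_eq_self_of_surjective hf] using h1

/-- Every maximal subgroup of a maximal subgroup is modular or S-quasinormal. -/
def HasGoodTwoMaximals (G : Type*) [Group G] : Prop :=
  ∀ M T : Subgroup G, IsCoatom M → T ⋖ M → IsModularSubgroup T ∨ IsSQuasinormal T

theorem HasGoodTwoMaximals.quotient [Finite G] (h : HasGoodTwoMaximals G) (R : Subgroup G)
    [R.Normal] : HasGoodTwoMaximals (G ⧸ R) := by
  intro M T hM hT
  have hf := QuotientGroup.mk'_surjective R
  have hM' : IsCoatom (M.comap (QuotientGroup.mk' R)) := by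
    rw [← covBy_top_iff] at hM ⊢
    exact comap_covBy_comap hf hM
  rw [← map_comap_eq_self_of_surjective hf T]
  exact (h _ _ hM' (comap_covBy_comap hf hT)).imp (fun h => h.map hf) fun h => h.map hf

theorem HasGoodTwoMaximals.hasSmallCoatomCores [Finite G] (h : HasGoodTwoMaximals G)
    {M : Subgroup G} (hM : IsCoatom M) : HasSmallCoatomCores M := by
  refine HasSmallCoatomCores.of_isModular_or_isSQuasinormal fun T hT => ?_
  have hle : T.map M.subtype ≤ M := map_subtype_le T
  have h1 := h M _ hM hT.map_subtype_covBy
  have h2 : (T.map M.subtype).subgroupOf M = T := 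
    comap_map_eq_self_of_injective M.subtype_injective T
  rw [← h2]
  exact h1.imp (fun h => h.comap M.subtype_injective (by rwa [range_subtype]))
    fun h => h.subgroupOf hle

theorem HasSmallCoatomCores.commutator_commutator_le_frattini [Finite G]
    (h : HasSmallCoatomCores G) :
    ⁅_root_.commutator G, _root_.commutator G⁆ ≤ frattini G := by
  refine le_iInf₂ fun M hM => ?_
  obtain ⟨p, q, S, -, -, -, -, -, -, -, hc, hcS⟩ := (h M hM).exists_normal_between
  exact ((commutator_mono hcS hcS).trans hc).trans M.normalCore_le

theorem HasSmallCoatomCores.isSolvable [Finite G] (h : HasSmallCoatomCores G) :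
    Group.IsSolvable G := by
  have := frattini_nilpotent (G := G)
  have hq : Group.IsSolvable (G ⧸ frattini G) := by
    refine ⟨⟨2, ?_⟩⟩
    rw [← map_derivedSeries_eq (QuotientGroup.mk'_surjective (frattini G)), eq_bot_iff,
      map_le_iff_le_comap, MonoidHom.comap_bot, QuotientGroup.ker_mk']
    exact h.commutator_commutator_le_frattini
  exact Group.isSolvable_of_ker_le_range (frattini G).subtype (QuotientGroup.mk' (frattini G))
    (by rw [QuotientGroup.ker_mk', range_subtype])

theorem exists_normal_forall_mem_iff_pow_eq_one {N : Subgroup G} (hN : N.Normal)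
    (hab : N ≤ centralizer (N : Set G)) (n : ℕ) :
    ∃ L : Subgroup G, L.Normal ∧ ∀ x, x ∈ L ↔ x ∈ N ∧ x ^ n = 1 := by
  refine ⟨{ carrier := {x | x ∈ N ∧ x ^ n = 1}, mul_mem' := ?_, one_mem' := ?_, inv_mem' := ?_ },
    ⟨?_⟩, fun x => Iff.rfl⟩
  · rintro a b ⟨ha, ha'⟩ ⟨hb, hb'⟩
    refine ⟨N.mul_mem ha hb, ?_⟩
    have hc : Commute a b := mem_centralizer_iff.1 (hab hb) a ha
    rw [hc.mul_pow, ha', hb', one_mul]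
  · exact ⟨N.one_mem, one_pow n⟩
  · rintro a ⟨ha, ha'⟩
    exact ⟨N.inv_mem ha, by rw [inv_pow, ha', inv_one]⟩
  · rintro a ⟨ha, ha'⟩ g
    exact ⟨hN.conj_mem a ha g, by rw [conj_pow, ha', mul_one, mul_inv_cancel]⟩

theorem exists_prime_forall_pow_eq_one [Finite G] {N : Subgroup G} (hN : N.Normal) (hb : N ≠ ⊥)
    (hmin : ∀ L : Subgroup G, L.Normal → L ≤ N → L = ⊥ ∨ L = N)
    (hab : N ≤ centralizer (N : Set G)) : ∃ p : ℕ, p.Prime ∧ ∀ x ∈ N, x ^ p = 1 := by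
  have h1 := (one_lt_card_iff_ne_bot N).2 hb
  obtain ⟨p, hp, hd⟩ := Nat.exists_prime_and_dvd h1.ne'
  have := Fact.mk hp
  obtain ⟨x, hx⟩ := exists_prime_orderOf_dvd_card' p hd
  obtain ⟨L, hL, hmem⟩ := exists_normal_forall_mem_iff_pow_eq_one hN hab p
  refine ⟨p, hp, fun y hy => ?_⟩
  rcases hmin L hL fun a ha => ((hmem a).1 ha).1 with h | h
  · have h2 : (x : G) ∈ L :=
      (hmem x).2 ⟨x.2, by rw [← coe_pow, ← hx, pow_orderOf_eq_one, coe_one]⟩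
    rw [h, mem_bot, OneMemClass.coe_eq_one] at h2
    rw [h2, orderOf_one] at hx
    exact absurd hx hp.one_lt.ne
  · exact ((hmem y).1 (h ▸ hy)).2

theorem IsPGroup.of_forall_mem_pow_eq_one {p : ℕ} {N : Subgroup G} (h : ∀ x ∈ N, x ^ p = 1) :
    IsPGroup p N :=
  fun x => ⟨1, Subtype.ext (by rw [pow_one, coe_pow, h x x.2, coe_one])⟩

/-- A normal `p`-subgroup centralizes every minimal normal `p`-subgroup. -/
theorem IsPGroup.le_centralizer_of_minimal [Finite G] {p : ℕ} [hp : Fact p.Prime]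
    {N O : Subgroup G} (hN : N.Normal) (hO : O.Normal) (hb : N ≠ ⊥)
    (hmin : ∀ L : Subgroup G, L.Normal → L ≤ N → L = ⊥ ∨ L = N) (hNp : IsPGroup p N)
    (hOp : IsPGroup p O) : O ≤ centralizer (N : Set G) := by
  have : Nontrivial N := (nontrivial_iff_ne_bot N).2 hb
  let _ : MulAction O N := MulAction.compHom N ((MulAut.conjNormal (H := N)).comp O.subtype)
  have hsmul : ∀ (o : O) (n : N), ((o • n : N) : G) = o * n * (o : G)⁻¹ :=
    fun o n => MulAut.conjNormal_apply (o : G) n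
  obtain ⟨k, hk, hcard⟩ := hNp.nontrivial_iff_card.1 this
  have h1 : (1 : N) ∈ MulAction.fixedPoints O N := fun o => by
    apply Subtype.ext
    rw [hsmul, coe_one, mul_one, mul_inv_cancel]
  obtain ⟨b, hbf, hb1⟩ := hOp.exists_fixed_point_of_prime_dvd_card_of_fixed_point N
    (hcard ▸ dvd_pow_self p hk.ne') h1
  rw [le_centralizer_iff]
  have h2 : centralizer (O : Set G) ⊓ N = N := by
    refine (hmin _ inferInstance inf_le_right).resolve_left fun h => hb1 ?_
    have h3 : (b : G) ∈ centralizer (O : Set G) ⊓ N := by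
      refine ⟨mem_centralizer_iff.2 fun o ho => ?_, b.2⟩
      have h4 := congr_arg Subtype.val (hbf ⟨o, ho⟩)
      rw [hsmul] at h4
      exact mul_inv_eq_iff_eq_mul.1 h4
    rw [h, mem_bot] at h3
    exact Subtype.ext h3.symm
  exact h2 ▸ inf_le_left

theorem mem_of_pow_mem_of_pow_eq_one {R : Subgroup G} {x : G} {n p q k : ℕ} (hp : p.Prime)
    (hq : q.Prime) (hqp : q ≠ p) (hn : n = 1 ∨ n = p) (hx : x ^ q ^ k = 1) (h : x ^ n ∈ R) :
    x ∈ R := by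
  have h1 : n.Coprime (orderOf x) := by
    refine Nat.Coprime.coprime_dvd_right (orderOf_dvd_of_pow_eq_one hx) ?_
    rcases hn with rfl | rfl
    · exact Nat.coprime_one_left _
    · exact Nat.Coprime.pow_right _ ((Nat.coprime_primes hp hq).2 hqp.symm)
  obtain ⟨m, hm⟩ := exists_pow_eq_self_of_coprime h1
  exact hm ▸ R.pow_mem h m

theorem IsSQuasinormal.mem_normalizer_pResidual [Finite G] {T : Subgroup G}
    (hT : IsSQuasinormal T) {p k : ℕ} (hp : p.Prime) {g : G} (hg : g ^ p ^ k = 1) :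
    g ∈ normalizer (T.pResidual p : Set G) := by
  have := Fact.mk hp
  obtain ⟨P, hP⟩ := (isPGroup_zpowers hg).exists_le_sylow
  have hTH : T ≤ T ⊔ (P : Subgroup G) := le_sup_left
  obtain ⟨a, ha⟩ := IsPGroup.iff_card.1 P.isPGroup'
  obtain ⟨b, -, hb⟩ := (Nat.dvd_prime_pow hp).1 (ha ▸ T.relIndex_dvd_card (P : Subgroup G))
  rw [← relIndex_sup_of_mul_comm (hT p hp P)] at hb
  have h1 : T.pResidual p = (T ⊔ (P : Subgroup G)).pResidual p := by
    refine pResidual_eq_of_le hTH fun x hx q k hq hqp hxk => ?_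
    exact (hT.subgroupOf hTH).mem_of_pow_eq_one (x := ⟨x, hx⟩) hp hb hq hqp (Subtype.ext hxk)
  rw [h1]
  exact normalizer_le_normalizer_pResidual p _
    (le_normalizer (mem_sup_right (hP (mem_zpowers g))))

theorem IsCoatomModular.mem_normalCore_of_pow_eq_one [Finite G] {M : Subgroup G}
    (h : IsCoatomModular M) (hM : M ≠ ⊤) {p : ℕ} (hp : p.Prime)
    (hmin : ∀ q : ℕ, q.Prime → q ∣ Nat.card G → p ≤ q) {g : G} (hg : g ∉ M) (hgp : g ^ p = 1)
    {q k : ℕ} {x : G} (hq : q.Prime) (hqp : q ≠ p) (hx : x ∈ M) (hxq : x ^ q ^ k = 1) :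
    x ∈ M.normalCore := by
  obtain ⟨u, v, S, hu, hv, hvu, hS, hRS, hSi, hRi, -, -⟩ :=
    (h.isPrimeMulSmaller hM).exists_normal_between
  have hidx : M.normalCore.index = u * v := by
    rw [← hRi, ← hSi, relIndex_mul_index hRS]
  have hv' : v = 1 ∨ v = p := by
    have h1 : p ∣ M.normalCore.index := by
      by_contra hd
      have hc : (M.normalCore.index).Coprime (orderOf g) :=
        Nat.Coprime.coprime_dvd_right (orderOf_dvd_of_pow_eq_one hgp)
          ((hp.coprime_iff_not_dvd.2 hd).symm)
      obtain ⟨m, hm⟩ := exists_pow_eq_self_of_coprime hc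
      exact hg (M.normalCore_le (hm ▸ pow_mem (M.normalCore.pow_index_mem g) m))
    rw [hidx] at h1
    rcases hv with hv | hv
    · exact Or.inl hv
    rcases hp.dvd_mul.1 h1 with h1 | h1
    · have h2 : v ∣ Nat.card G := hSi ▸ S.index_dvd_card
      rw [Nat.prime_dvd_prime_iff_eq hp hu] at h1
      exact absurd (hmin v hv h2) (by omega)
    · exact Or.inr ((Nat.prime_dvd_prime_iff_eq hp hv).1 h1).symm
  have hSM : S ⊓ M ≤ M.normalCore := by
    have h1 : M.normalCore ≤ S ⊓ M := le_inf hRS M.normalCore_le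
    have h2 := relIndex_mul_relIndex _ _ _ h1 (inf_le_left : S ⊓ M ≤ S)
    rw [hRi] at h2
    rcases (Nat.dvd_prime hu).1 (Dvd.intro _ h2) with h3 | h3
    · exact relIndex_eq_one.1 h3
    · rw [h3] at h2
      have h4 : (S ⊓ M).relIndex S = 1 := Nat.eq_of_mul_eq_mul_left hu.pos (by rw [h2, mul_one])
      have h5 : S ≤ M := (relIndex_eq_one.1 h4).trans inf_le_right
      have h6 : S ≤ M.normalCore := normal_le_normalCore.2 h5
      rw [relIndex_eq_one.2 h6] at hRi
      exact absurd hRi.symm hu.one_lt.ne'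
  refine mem_of_pow_mem_of_pow_eq_one hp hq hqp hv' hxq (hSM ⟨?_, M.pow_mem hx v⟩)
  exact hSi ▸ S.pow_index_mem x

theorem IsModularSubgroup.mem_normalizer_pResidual [Finite G] {T : Subgroup G}
    (hT : IsModularSubgroup T) {p : ℕ} (hp : p.Prime)
    (hmin : ∀ q : ℕ, q.Prime → q ∣ Nat.card G → p ≤ q) {g : G} (hg : g ^ p = 1) :
    g ∈ normalizer (T.pResidual p : Set G) := by
  by_cases hgT : g ∈ T
  · exact normalizer_le_normalizer_pResidual p T (le_normalizer hgT)
  set W := T ⊔ zpowers g with hW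
  have hTW : T ≤ W := le_sup_left
  have hgW : g ∈ W := mem_sup_right (mem_zpowers g)
  have hbetween : ∀ L, T ≤ L → L ≤ W → L = T ∨ L = W := by
    intro L hTL hLW
    have h1 := hT.2 (zpowers g) L hTL
    rw [← hW, inf_eq_right.2 hLW] at h1
    by_cases hgL : g ∈ L
    · rw [inf_eq_left.2 (zpowers_le.2 hgL)] at h1
      exact Or.inr h1.symm
    · have hbot : zpowers g ⊓ L = ⊥ := by
        rw [eq_bot_iff]
        rintro y ⟨hy, hyL⟩
        obtain ⟨n, rfl⟩ := mem_zpowers_iff.1 hy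
        by_contra hne
        have hnd : ¬ (p : ℤ) ∣ n := by
          rintro ⟨m, rfl⟩
          exact hne (by rw [zpow_mul, zpow_natCast, hg, one_zpow]; exact one_mem _)
        have hc : IsCoprime n (p : ℤ) :=
          ((Nat.prime_iff_prime_int.1 hp).coprime_iff_not_dvd.2 hnd).symm
        obtain ⟨a, b, hab⟩ := hc
        refine hgL ?_
        have : g = (g ^ n) ^ a := by
          rw [← zpow_mul, mul_comm n a, ← mul_one (g ^ (a * n))]
          conv_lhs => rw [← zpow_one g, ← hab, zpow_add, mul_comm b, zpow_mul g p b, zpow_natCast,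
            hg, one_zpow]
        rw [this]
        exact L.zpow_mem hyL a
      rw [hbot, sup_bot_eq] at h1
      exact Or.inl h1.symm
  have hcoatom : IsCoatom (T.subgroupOf W) := by
    refine ⟨fun h => hgT (subgroupOf_eq_top.1 h hgW), fun X hX => ?_⟩
    have hX1 : T ≤ X.map W.subtype := by
      intro t ht
      exact ⟨⟨t, hTW ht⟩, hX.le (mem_subgroupOf.2 ht), rfl⟩
    rcases hbetween _ hX1 (map_subtype_le X) with h | h
    · refine absurd ?_ hX.not_ge
      intro x hx
      exact mem_subgroupOf.2 (h ▸ mem_map_of_mem W.subtype hx)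
    · refine top_le_iff.1 fun x _ => ?_
      obtain ⟨y, hy, hyx⟩ := h.ge x.2
      rwa [← Subtype.ext hyx]
  have hstar : IsCoatomModular (T.subgroupOf W) :=
    (hT.comap W.subtype_injective (by rwa [range_subtype])).isCoatomModular hcoatom
  set R := (T.subgroupOf W).normalCore.map W.subtype with hR
  have hRT : R ≤ T := by
    rintro _ ⟨y, hy, rfl⟩
    exact mem_subgroupOf.1 ((T.subgroupOf W).normalCore_le hy)
  have hres : R.pResidual p = T.pResidual p := by
    refine pResidual_eq_of_le hRT fun x hx q k hq hqp hxk => ?_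
    refine ⟨⟨x, hTW hx⟩, hstar.mem_normalCore_of_pow_eq_one hcoatom.1 hp ?_ (g := ⟨g, hgW⟩)
      (fun h => hgT (mem_subgroupOf.1 h)) (Subtype.ext hg) hq hqp (mem_subgroupOf.2 hx)
      (k := k) (Subtype.ext hxk), rfl⟩
    exact fun r hr hd => hmin r hr (hd.trans W.card_subgroup_dvd_card)
  rw [← hres]
  refine normalizer_le_normalizer_pResidual p R ?_
  have h1 := le_normalizer_map (H := (T.subgroupOf W).normalCore) W.subtype
  rw [normalizer_eq_top, ← MonoidHom.range_eq_map, range_subtype] at h1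
  exact h1 hgW

theorem HasGoodTwoMaximals.isPrimeMulSmaller_of_simple [Finite G] (h : HasGoodTwoMaximals G)
    (hG : ∀ N : Subgroup G, N.Normal → N = ⊥ ∨ N = ⊤) {M : Subgroup G} (hM : IsCoatom M) :
    IsPrimeMulSmaller (Nat.card G) := by
  have hG1 : Nat.card G ≠ 1 := fun h1 => hM.1 <| by
    have := (Nat.card_eq_one_iff_unique.1 h1).1
    exact Subsingleton.elim _ _
  set p := (Nat.card G).minFac with hpdef
  have hp : p.Prime := Nat.minFac_prime hG1
  have := Fact.mk hp
  have hmin : ∀ q : ℕ, q.Prime → q ∣ Nat.card G → p ≤ q :=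
    fun q hq hd => Nat.minFac_le_of_dvd hq.two_le hd
  by_cases hpG : IsPGroup p G
  · exact (hpG.card_prime_of_simple hG hM).isPrimeMulSmaller
  exfalso
  have hgen : closure {g : G | g ^ p = 1} = ⊤ := by
    have hn : (closure {g : G | g ^ p = 1}).Normal := by
      refine ⟨fun n hn g => ?_⟩
      have h1 : closure {g : G | g ^ p = 1} ≤
          (closure {g : G | g ^ p = 1}).comap (MulAut.conj g).toMonoidHom := by
        refine (closure_le _).2 fun y hy => subset_closure ?_
        change (g * y * g⁻¹) ^ p = 1
        rw [conj_pow, show y ^ p = 1 from hy, mul_one, mul_inv_cancel]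
      exact h1 hn
    refine (hG _ hn).resolve_left fun hb => ?_
    obtain ⟨x, hx⟩ := exists_prime_orderOf_dvd_card' p (Nat.minFac_dvd (Nat.card G))
    have h1 : x ∈ closure {g : G | g ^ p = 1} :=
      subset_closure (show x ^ p = 1 by rw [← hx, pow_orderOf_eq_one])
    rw [hb, mem_bot] at h1
    rw [h1, orderOf_one] at hx
    exact hp.one_lt.ne hx
  have hTp : ∀ M T : Subgroup G, IsCoatom M → T ⋖ M → IsPGroup p T := by
    intro M T hM hT
    have h1 : (T.pResidual p).Normal := by
      rw [← normalizer_eq_top_iff, eq_top_iff, ← hgen, closure_le]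
      intro g hg
      rcases h M T hM hT with h2 | h2
      · exact h2.mem_normalizer_pResidual hp hmin hg
      · exact h2.mem_normalizer_pResidual (k := 1) hp (by rw [pow_one]; exact hg)
    refine isPGroup_of_pResidual_eq_bot ((hG _ h1).resolve_right fun h2 => hM.1 ?_)
    exact top_le_iff.1 (h2 ▸ (pResidual_le p T).trans hT.le)
  obtain ⟨q, hq, hqd, hqp⟩ : ∃ q : ℕ, q.Prime ∧ q ∣ Nat.card G ∧ q ≠ p := by
    by_contra! hno
    exact hpG (IsPGroup.of_forall_prime_dvd hno)
  have := Fact.mk hq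
  have hqG : ¬ IsPGroup q G := by
    intro hqG
    obtain ⟨n, hn⟩ := IsPGroup.iff_card.1 hqG
    have h1 : p ∣ q ^ n := hn ▸ Nat.minFac_dvd (Nat.card G)
    exact hqp ((Nat.prime_dvd_prime_iff_eq hp hq).1 (hp.dvd_of_dvd_pow h1)).symm
  obtain ⟨Q⟩ := (inferInstance : Nonempty (Sylow q G))
  have hbot : ∀ M T : Subgroup G, IsCoatom M → T ⋖ M → T ≤ (Q : Subgroup G) → T = ⊥ := by
    intro M T hM hT hTQ
    have h1 := (hTp M T hM hT).disjoint_of_ne p q hqp.symm T T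
      (Q.isPGroup'.to_le hTQ)
    exact disjoint_self.1 h1
  have hQb : (Q : Subgroup G) ≠ ⊥ := Q.ne_bot_of_dvd_card hqd
  have hN : normalizer ((Q : Subgroup G) : Set G) ≠ ⊤ := by
    intro h1
    rcases hG Q (normalizer_eq_top_iff.1 h1) with h2 | h2
    · exact hQb h2
    · exact hqG (IsPGroup.eq_top_of_sylow_eq_top h2)
  obtain ⟨M', hM', hle⟩ := (eq_top_or_exists_le_coatom _).resolve_left hN
  have hQM : (Q : Subgroup G) ≤ M' := le_normalizer.trans hle
  have hQeq : (Q : Subgroup G) = M' := by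
    by_contra hne
    obtain ⟨T, hQT, hT⟩ := exists_covBy_of_lt (lt_of_le_of_ne hQM hne)
    have h1 := (hTp M' T hM' hT).disjoint_of_ne p q hqp.symm T Q Q.isPGroup'
    exact hQb (disjoint_self.1 (h1.mono_left hQT))
  have hQprime : Nat.card (Q : Subgroup G) = 1 ∨ (Nat.card (Q : Subgroup G)).Prime := by
    refine card_eq_one_or_prime_of_forall_le fun X hX => ?_
    by_cases hXQ : X = Q
    · exact Or.inr hXQ
    obtain ⟨T, hXT, hT⟩ := exists_covBy_of_lt (lt_of_le_of_ne hX hXQ)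
    left
    have h1 := hbot M' T hM' (hQeq ▸ hT) hT.le
    exact le_bot_iff.1 (h1 ▸ hXT)
  refine Sylow.not_normalizer_le_centralizer hG hqd hqG Q (hle.trans (hQeq ▸ ?_))
  rw [card_eq_one, or_iff_right hQb] at hQprime
  have := Fact.mk hQprime
  have hcyc : IsCyclic (Q : Subgroup G) := isCyclic_of_prime_card rfl
  let _ : CommGroup (Q : Subgroup G) := hcyc.commGroup
  intro a ha
  refine mem_centralizer_iff.2 fun b hb => ?_
  exact congr_arg Subtype.val (mul_comm (⟨b, hb⟩ : (Q : Subgroup G)) ⟨a, ha⟩)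

theorem IsSQuasinormal.le_sylow [Finite G] {T : Subgroup G} (hT : IsSQuasinormal T) {p : ℕ}
    [hp : Fact p.Prime] (hTp : IsPGroup p T) (P : Sylow p G) : T ≤ P := by
  have h1 : IsPGroup p ↥(T ⊔ (P : Subgroup G)) := by
    obtain ⟨a, ha⟩ := IsPGroup.iff_card.1 P.isPGroup'
    obtain ⟨b, hb⟩ := IsPGroup.iff_card.1 hTp
    obtain ⟨c, -, hc⟩ := (Nat.dvd_prime_pow hp.1).1 (ha ▸ T.relIndex_dvd_card (P : Subgroup G))
    rw [← relIndex_sup_of_mul_comm (hT p hp.1 P)] at hc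
    refine IsPGroup.of_card (n := b + c) ?_
    rw [pow_add, ← hb, ← hc, ← relIndex_bot_left, ← relIndex_bot_left,
      relIndex_mul_relIndex _ _ _ bot_le le_sup_left]
  exact P.is_maximal' h1 le_sup_right ▸ le_sup_left

theorem Sylow.mem_normalCore_of_forall_mem {p : ℕ} [Fact p.Prime] [Finite G] (P : Sylow p G) {x : G}
    (h : ∀ Q : Sylow p G, x ∈ Q) : x ∈ (P : Subgroup G).normalCore := by
  intro g
  have h1 := h (g⁻¹ • P)
  have h2 : x ∈ MulAut.conj g⁻¹ • (P : Subgroup G) := h1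
  rw [mem_pointwise_smul_iff_inv_smul_mem, ← map_inv, inv_inv] at h2
  exact h2

theorem IsSQuasinormal.eq_bot_of_complement [Finite G] {T M N : Subgroup G}
    (hT : IsSQuasinormal T) (hTM : T ≤ M) (hN : N.Normal) (hb : N ≠ ⊥)
    (hmin : ∀ L : Subgroup G, L.Normal → L ≤ N → L = ⊥ ∨ L = N) (hNM : N ⊓ M = ⊥)
    (hC : centralizer (N : Set G) = N) : T = ⊥ := by
  obtain ⟨p, hp, hpow⟩ := exists_prime_forall_pow_eq_one hN hb hmin hC.ge
  have := Fact.mk hp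
  have hbot : ∀ X : Subgroup G, X ≤ M → X ≤ centralizer (N : Set G) → X = ⊥ := fun X h1 h2 =>
    le_bot_iff.1 (hNM ▸ le_inf (hC ▸ h2) h1)
  have hTp : IsPGroup p T := by
    refine isPGroup_of_pResidual_eq_bot (hbot _ ((pResidual_le p T).trans hTM) fun t ht => ?_)
    refine mem_centralizer_iff.2 fun n hn => ?_
    have h1 := hT.mem_normalizer_pResidual (k := 1) hp (g := n) (by rw [pow_one]; exact hpow n hn)
    exact mul_comm_of_conj_mem hNM hn (hTM (pResidual_le p T ht))
      (hTM (pResidual_le p T (((mem_normalizer_iff.1 h1) t).1 ht)))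
  obtain ⟨P⟩ := (inferInstance : Nonempty (Sylow p G))
  have h1 : T ≤ (P : Subgroup G).normalCore := fun x hx =>
    P.mem_normalCore_of_forall_mem fun Q => hT.le_sylow hTp Q hx
  exact hbot T hTM (h1.trans (IsPGroup.le_centralizer_of_minimal hN inferInstance hb hmin
    (IsPGroup.of_forall_mem_pow_eq_one hpow) (P.isPGroup'.to_le (normalCore_le _))))

theorem mem_normalizer_zpowers_of_conj_mem [Finite G] {n g : G} (h : g * n * g⁻¹ ∈ zpowers n) :
    g ∈ normalizer (zpowers n : Set G) := by
  rw [mem_normalizer_iff_map_conj_eq]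
  refine eq_of_le_of_card_ge ?_ ?_
  · rw [map_le_iff_le_comap, zpowers_le]
    exact h
  · rw [card_map_of_injective (MulAut.conj g).injective]

theorem IsModularSubgroup.eq_bot_of_complement [Finite G] {T M N : Subgroup G}
    (hT : IsModularSubgroup T) (hTM : T < M) (hM : IsCoatom M) (hN : N.Normal)
    (hmin : ∀ L : Subgroup G, L.Normal → L ≤ N → L = ⊥ ∨ L = N) (hNM : N ⊓ M = ⊥)
    (hsup : N ⊔ M = ⊤) (hC : centralizer (N : Set G) = N) : T = ⊥ := by
  by_contra hTb
  obtain ⟨t, ht, n, hn, htn⟩ : ∃ t ∈ T, ∃ n ∈ N, n * t ≠ t * n := by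
    by_contra! h
    refine hTb (le_bot_iff.1 (hNM ▸ le_inf ?_ hTM.le))
    rw [← hC]
    exact fun t ht => mem_centralizer_iff.2 (h t ht)
  have hn1 : n ≠ 1 := by
    rintro rfl
    exact htn (by rw [one_mul, mul_one])
  have hcomm : ∀ m ∈ M, n * m * n⁻¹ ∈ M → n * m = m * n :=
    fun m hm hc => mul_comm_of_conj_mem hNM hn hm hc
  have hTn : T ≤ normalizer (zpowers n : Set G) := by
    intro s hs
    have h1 := hT.1 (zpowers n) N (zpowers_le.2 hn)
    have h2 : T ⊓ N = ⊥ := le_bot_iff.1 (hNM ▸ le_inf inf_le_right (inf_le_left.trans hTM.le))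
    rw [h2, sup_bot_eq] at h1
    refine mem_normalizer_zpowers_of_conj_mem ?_
    rw [h1]
    have hs' : s ∈ zpowers n ⊔ T := mem_sup_right hs
    have hn' : n ∈ zpowers n ⊔ T := mem_sup_left (mem_zpowers n)
    exact ⟨Subgroup.mul_mem _ (Subgroup.mul_mem _ hs' hn') (Subgroup.inv_mem _ hs'),
      hN.conj_mem n hn s⟩
  set M' := M.comap (MulAut.conj n).toMonoidHom with hM'
  have hM'c : IsCoatom M' := by
    rw [← covBy_top_iff] at hM ⊢
    exact comap_covBy_comap (f := (MulAut.conj n).toMonoidHom) (MulAut.conj n).surjective hM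
  have h1 : T ⊔ M' = ⊤ :=
    hM'c.sup_eq_top_of_not_le fun h => htn (hcomm t (hTM.le ht) (h ht))
  have h2 := hT.2 M' M hTM.le
  rw [h1, top_inf_eq] at h2
  have hcm : ∀ m ∈ M' ⊓ M, n * m = m * n := fun m hm => hcomm m hm.2 hm.1
  have hMn : M ≤ normalizer (zpowers n : Set G) := by
    rw [← h2]
    refine sup_le hTn fun m hm => mem_normalizer_zpowers_of_conj_mem ?_
    rw [← hcm m hm, mul_inv_cancel_right]
    exact mem_zpowers n
  have hNn : N ≤ normalizer (zpowers n : Set G) := fun m hm => by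
    refine mem_normalizer_zpowers_of_conj_mem ?_
    rw [← mem_centralizer_iff.1 (hC.ge hm) n hn, mul_inv_cancel_right]
    exact mem_zpowers n
  have hnorm : (zpowers n).Normal := normalizer_eq_top_iff.1 (top_le_iff.1 (hsup ▸ sup_le hNn hMn))
  have hzN : zpowers n = N :=
    (hmin _ hnorm (zpowers_le.2 hn)).resolve_left fun h => hn1 (zpowers_eq_bot.1 h)
  have h3 : M' ⊓ M = ⊥ := by
    refine le_bot_iff.1 (hNM ▸ le_inf ?_ inf_le_right)
    rw [← hC, ← hzN]
    refine fun m hm => mem_centralizer_iff.2 fun y hy => ?_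
    obtain ⟨k, rfl⟩ := mem_zpowers_iff.1 hy
    exact Commute.zpow_left (hcm m hm) k
  rw [h3, sup_bot_eq] at h2
  exact hTM.ne h2

theorem HasGoodTwoMaximals.isPrimeMulSmaller_of_not_simple [Finite G] (h : HasGoodTwoMaximals G)
    {M K : Subgroup G} (hM : IsCoatom M) (hc : M.normalCore = ⊥) (hK : K.Normal) (hKb : K ≠ ⊥)
    (hKt : K ≠ ⊤) : IsPrimeMulSmaller (Nat.card G) := by
  obtain ⟨N, hN, hNb, hNK, hmin⟩ := exists_minimal_normal hK hKb
  have hab : N ≤ centralizer (N : Set G) := by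
    obtain ⟨M₁, hM₁, hKM₁⟩ := (eq_top_or_exists_le_coatom K).resolve_left hKt
    have h1 := (h.hasSmallCoatomCores hM₁).isSolvable
    have h2 : Group.IsSolvable N := Group.isSolvable_of_isSolvable_injective
      (inclusion_injective (hNK.trans hKM₁))
    have : Nontrivial N := (nontrivial_iff_ne_bot N).2 hNb
    exact le_centralizer_self_of_minimal hN hmin
      (Group.IsSolvable.commutator_lt_top_of_nontrivial N).ne
  obtain ⟨hNM, hsup, hC⟩ := hM.complement_of_normalCore_eq_bot hc hNb hab
  have hT : ∀ T, T ⋖ M → T = ⊥ := fun T hT => by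
    rcases h M T hM hT with h1 | h1
    · exact h1.eq_bot_of_complement hT.lt hM hN hmin hNM hsup hC
    · exact h1.eq_bot_of_complement hT.le hN hNb hmin hNM hC
  have hprime : ∀ X : Subgroup G, (∀ T, T ⋖ X → T = ⊥) → Nat.card X = 1 ∨ (Nat.card X).Prime := by
    refine fun X hX => card_eq_one_or_prime_of_forall_le fun Y hY => ?_
    by_cases hYX : Y = X
    · exact Or.inr hYX
    obtain ⟨T, hYT, hT⟩ := exists_covBy_of_lt (lt_of_le_of_ne hY hYX)
    exact Or.inl (le_bot_iff.1 (hX T hT ▸ hYT))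
  have hMb : M ≠ ⊥ := by
    rintro rfl
    rw [sup_bot_eq] at hsup
    exact hKt (top_le_iff.1 (hsup ▸ hNK))
  have hq : (Nat.card M).Prime :=
    (hprime M hT).resolve_left fun h1 => hMb (card_eq_one.1 h1)
  have hidx := index_eq_card_of_complement hNM hsup
  have hNc : IsCoatom N := by
    refine ⟨fun h1 => hKt (top_le_iff.1 (h1 ▸ hNK)), fun X hX => ?_⟩
    have h1 := relIndex_mul_index hX.le
    rw [hidx] at h1
    rcases (Nat.dvd_prime hq).1 (Dvd.intro _ h1) with h2 | h2
    · exact absurd (relIndex_eq_one.1 h2) hX.not_ge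
    · rw [h2] at h1
      exact index_eq_one.1 (Nat.eq_of_mul_eq_mul_left hq.pos (by rw [h1, mul_one]))
  have := Fact.mk hq
  have hL : ∀ L, L ⋖ N → L = ⊥ := by
    intro L hL
    by_contra hLb
    have hLM : M ⊔ L = ⊤ := by
      rw [sup_comm]
      exact hM.sup_eq_top_of_not_le fun h1 => hLb (le_bot_iff.1 (hNM ▸ le_inf hL.le h1))
    rcases h N L hNc hL with h1 | h1
    · have h2 := h1.2 M N hL.le
      rw [sup_comm L M, hLM, top_inf_eq, inf_comm, hNM, sup_bot_eq] at h2
      exact hL.ne h2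
    · obtain ⟨Q, hQ⟩ := (IsPGroup.of_card (n := 1) (by rw [pow_one]) :
        IsPGroup (Nat.card M) M).exists_le_sylow
      rcases hM.le_iff.1 hQ with h2 | h2
      · have h3 : M.Normal := (IsPGroup.eq_top_of_sylow_eq_top h2).normal_of_isCoatom hM
        exact hMb (by rw [← hc, M.normalCore_eq_self])
      · have h3 := relIndex_sup_of_mul_comm (h2 ▸ (h1 _ hq Q).symm : (M : Set G) * L = L * M)
        rw [hLM, relIndex_top_right] at h3
        have h4 : M.index = Nat.card N := by
          have h5 := M.card_mul_index
          rw [← N.card_mul_index, hidx, mul_comm] at h5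
          exact Nat.eq_of_mul_eq_mul_right hq.pos h5
        have h5 := Nat.le_of_dvd Nat.card_pos (M.relIndex_dvd_card L)
        rw [← h3, h4] at h5
        exact hL.ne (eq_of_le_of_card_ge hL.le h5)
  refine isPrimeMulSmaller_card ((hprime N hL).resolve_left fun h1 => hNb (card_eq_one.1 h1))
    hC.le (Or.inr (hidx ▸ hq))

theorem HasSmallCoatomCores.of_hasGoodTwoMaximals [Finite G] (h : HasGoodTwoMaximals G) :
    HasSmallCoatomCores G := by
  intro M hM
  rw [index_eq_card]
  have h1 := h.quotient M.normalCore
  have h2 := hM.map_mk M.normalCore_le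
  by_cases hs : ∀ N : Subgroup (G ⧸ M.normalCore), N.Normal → N = ⊥ ∨ N = ⊤
  · exact h1.isPrimeMulSmaller_of_simple hs h2
  · push Not at hs
    obtain ⟨K, hK, hKb, hKt⟩ := hs
    exact h1.isPrimeMulSmaller_of_not_simple h2 (normalCore_map_normalCore M) hK hKb hKt

theorem HasSmallCoatomCores.quotient (h : HasSmallCoatomCores G) (R : Subgroup G) [R.Normal] :
    HasSmallCoatomCores (G ⧸ R) := by
  intro M hM
  have hf := QuotientGroup.mk'_surjective R
  rw [← index_normalCore_comap hf]
  refine h _ ?_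
  rw [← covBy_top_iff] at hM ⊢
  exact comap_covBy_comap hf hM

theorem HasSmallCoatomCores.le_centralizer_of_minimal [Finite G] (h : HasSmallCoatomCores G)
    {N : Subgroup G} (hN : N.Normal) (hb : N ≠ ⊥)
    (hmin : ∀ L : Subgroup G, L.Normal → L ≤ N → L = ⊥ ∨ L = N) :
    N ≤ centralizer (N : Set G) := by
  have := h.isSolvable
  have : Nontrivial N := (nontrivial_iff_ne_bot N).2 hb
  exact le_centralizer_self_of_minimal hN hmin
    (Group.IsSolvable.commutator_lt_top_of_nontrivial N).ne

theorem HasSmallCoatomCores.card_prime_of_not_le_frattini [Finite G] (h : HasSmallCoatomCores G)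
    {N : Subgroup G} (hN : N.Normal) (hb : N ≠ ⊥)
    (hmin : ∀ L : Subgroup G, L.Normal → L ≤ N → L = ⊥ ∨ L = N) (hF : ¬ N ≤ frattini G) :
    (Nat.card N).Prime ∧ ∃ r : ℕ, r.Prime ∧ (centralizer (N : Set G)).index ∣ r := by
  obtain ⟨M, hM, hNM⟩ : ∃ M : Subgroup G, IsCoatom M ∧ ¬ N ≤ M := by
    by_contra! hno
    exact hF (le_iInf₂ hno)
  have hNR : N ⊓ M.normalCore = ⊥ := (hmin _ inferInstance inf_le_left).resolve_right fun h1 =>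
    hNM ((inf_eq_left.1 h1).trans M.normalCore_le)
  have hN1 : Nat.card N ≠ 1 := fun h1 => hb (card_eq_one.1 h1)
  obtain ⟨p, q, S, hp, hq, -, hS, hRS, hSi, hRi, hSS, -⟩ := (h M hM).exists_normal_between
  have hrel : ∀ A : Subgroup G, N ⊓ A = ⊥ → A.relIndex N = Nat.card N := fun A hA => by
    rw [← inf_relIndex_right, inf_comm, hA, relIndex_bot_left]
  have hmain : (Nat.card N).Prime ∧ ⁅N, S⁆ = ⊥ := by
    rcases hmin (N ⊓ S) inferInstance inf_le_left with h1 | h1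
    · refine ⟨?_, le_bot_iff.1 (h1 ▸ commutator_le_inf N S)⟩
      have h2 := relIndex_dvd_index_of_normal S N
      rw [hrel S h1, hSi] at h2
      rcases hq with rfl | hq
      · exact absurd (Nat.dvd_one.1 h2) hN1
      · rwa [((Nat.dvd_prime hq).1 h2).resolve_left hN1]
    · have hNS := inf_eq_left.1 h1
      refine ⟨?_, le_bot_iff.1 (hNR ▸ le_inf (commutator_le_left N S)
        ((commutator_mono hNS le_rfl).trans hSS))⟩
      have h2 := relIndex_dvd_index_of_normal (M.normalCore.subgroupOf S) (N.subgroupOf S)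
      rw [relIndex_subgroupOf hNS, hrel _ hNR] at h2
      have h3 : (M.normalCore.subgroupOf S).index = p := hRi
      rw [h3] at h2
      rwa [((Nat.dvd_prime hp).1 h2).resolve_left hN1]
  refine ⟨hmain.1, ?_⟩
  have hSC : S ≤ centralizer (N : Set G) :=
    le_centralizer_iff.1 (commutator_eq_bot_iff_le_centralizer.1 hmain.2)
  have h1 := index_dvd_of_le hSC
  rw [hSi] at h1
  rcases hq with rfl | hq
  · exact ⟨2, Nat.prime_two, h1.trans (one_dvd 2)⟩
  · exact ⟨q, hq, h1⟩

theorem exists_eigenvector_of_iterate_eq {p : ℕ} [hp : Fact p.Prime] {A : Type*} [AddCommGroup A]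
    [Module (ZMod p) A] [Finite A] [Nontrivial A] (f : A →+ A) (hf : ∀ a, f^[p] a = f a) :
    ∃ a : A, a ≠ 0 ∧ ∃ k : ℕ, f a = k • a := by
  let F : Module.End (ZMod p) A := f.toZModLinearMap p
  have hF : Polynomial.aeval F (Polynomial.X ^ p - Polynomial.X : Polynomial (ZMod p)) = 0 := by
    rw [map_sub, map_pow, Polynomial.aeval_X, sub_eq_zero]
    ext a
    rw [Module.End.pow_apply]
    exact hf a
  have hint : IsIntegral (ZMod p) F :=
    ⟨_, Polynomial.monic_X_pow_sub (by rw [Polynomial.degree_X]; exact_mod_cast hp.1.one_lt), hF⟩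
  have hs : (Polynomial.X ^ p - Polynomial.X : Polynomial (ZMod p)).Splits := by
    have := FiniteField.splits_X_pow_card_sub_X p (K := ZMod p)
    simpa using this
  obtain ⟨μ, hμ⟩ := (hs.of_dvd (FiniteField.X_pow_card_sub_X_ne_zero (ZMod p) hp.1.one_lt)
    (minpoly.dvd _ _ hF)).exists_eval_eq_zero (minpoly.degree_pos hint).ne'
  obtain ⟨v, hv⟩ := (Module.End.hasEigenvalue_of_isRoot hμ).exists_hasEigenvector
  refine ⟨v, hv.2, μ.val, ?_⟩
  have h1 : F v = μ • v := hv.apply_eq_smul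
  have h2 : (μ.val : ZMod p) • v = μ.val • v := Nat.cast_smul_eq_nsmul (ZMod p) μ.val v
  rw [← h2, ZMod.natCast_zmod_val]
  exact h1

theorem exists_conj_eq_pow [Finite G] {p : ℕ} (hp : p.Prime) {N : Subgroup G} (hN : N.Normal)
    (hb : N ≠ ⊥) (hab : N ≤ centralizer (N : Set G)) (hpow : ∀ n ∈ N, n ^ p = 1) {x : G}
    (hx : x ^ (p - 1) ∈ centralizer (N : Set G)) :
    ∃ n ∈ N, n ≠ 1 ∧ ∃ k : ℕ, x * n * x⁻¹ = n ^ k := by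
  have := Fact.mk hp
  let _ : CommGroup N :=
    { (inferInstance : Group N) with
      mul_comm := fun a b => Subtype.ext (mem_centralizer_iff.1 (hab b.2) a a.2) }
  have : Nontrivial N := (nontrivial_iff_ne_bot N).2 hb
  let f : Additive N →+ Additive N := (MulAut.conjNormal x : MulAut N).toMonoidHom.toAdditive
  have hit : ∀ (m : ℕ) (a : N), f^[m] (Additive.ofMul a) =
      Additive.ofMul ((MulAut.conjNormal (x ^ m) : MulAut N) a) := by
    intro m
    induction m with
    | zero => intro a; simp
    | succ m ih =>
      intro a
      rw [Function.iterate_succ_apply', ih, pow_succ', map_mul]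
      rfl
  let _ : Module (ZMod p) (Additive N) := AddCommGroup.zmodModule fun a => by
    apply Additive.toMul.injective
    exact Subtype.ext (hpow _ a.toMul.2)
  obtain ⟨a, ha, k, hk⟩ := exists_eigenvector_of_iterate_eq (p := p) f (fun a => by
      have h1 := hit p a.toMul
      have h2 : (MulAut.conjNormal (x ^ (p - 1)) : MulAut N) = 1 := by
        rw [← MonoidHom.mem_ker, ker_conjNormal_eq_centralizer]
        exact hx
      rw [show p = (p - 1) + 1 from (Nat.succ_pred_prime hp).symm, pow_succ', map_mul, h2,
        mul_one] at h1
      rw [show p = (p - 1) + 1 from (Nat.succ_pred_prime hp).symm]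
      exact h1)
  refine ⟨(a.toMul : N), a.toMul.2, fun h => ha ?_, k, ?_⟩
  · apply Additive.toMul.injective
    exact Subtype.ext h
  · have h1 := congr_arg (fun b : Additive N => ((b.toMul : N) : G)) hk
    have h2 : (((f a).toMul : N) : G) = x * (a.toMul : N) * x⁻¹ := MulAut.conjNormal_apply x _
    rw [← h2]
    exact h1

theorem Sylow.map_subtype_normal_of_le_sup_frattini [Finite G] {q : ℕ} [Fact q.Prime]
    {A : Subgroup G} [A.Normal] (S : Sylow q A)
    (h : A ≤ (S : Subgroup A).map A.subtype ⊔ frattini G) :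
    ((S : Subgroup A).map A.subtype).Normal := by
  refine normalizer_eq_top_iff.1 (frattini_nongenerating (top_le_iff.1 ?_))
  rw [← S.normalizer_sup_eq_top]
  refine sup_le le_sup_left (h.trans (sup_le_sup_right le_normalizer _))

/-- Every nontrivial normal subgroup of prime power order is a `p`-group. -/
def IsPrimaryAt (G : Type*) [Group G] (p : ℕ) : Prop :=
  ∀ (q : ℕ), q.Prime → q ≠ p → ∀ K : Subgroup G, K.Normal → IsPGroup q K → K = ⊥

theorem IsPrimaryAt.isPGroup_frattini [Finite G] {p : ℕ} (hO : IsPrimaryAt G p) :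
    IsPGroup p (frattini G) := by
  refine IsPGroup.of_forall_prime_dvd fun q hq hd => ?_
  by_contra hqp
  have := Fact.mk hq
  obtain ⟨S⟩ := (inferInstance : Nonempty (Sylow q (frattini G)))
  have h1 := hO q hq hqp _ (S.map_subtype_normal_of_le_sup_frattini le_sup_right)
    (S.isPGroup'.map _)
  exact S.ne_bot_of_dvd_card hd ((map_eq_bot_iff_of_injective _ (subtype_injective _)).1 h1)

theorem IsPrimaryAt.quotient_frattini [Finite G] {p : ℕ} (hO : IsPrimaryAt G p) :
    IsPrimaryAt (G ⧸ frattini G) p := by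
  intro q hq hqp B hB hBq
  have := Fact.mk hq
  have hf := QuotientGroup.mk'_surjective (frattini G)
  set A := B.comap (QuotientGroup.mk' (frattini G)) with hA
  have hΦA : frattini G ≤ A := by
    have := (QuotientGroup.mk' (frattini G)).ker_le_comap B
    rwa [QuotientGroup.ker_mk'] at this
  obtain ⟨S⟩ := (inferInstance : Nonempty (Sylow q A))
  have hle : A ≤ (S : Subgroup A).map A.subtype ⊔ frattini G := by
    have h1 : (S : Subgroup A) ⊔ (frattini G).subgroupOf A = ⊤ := by
      obtain ⟨k, hk⟩ := IsPGroup.iff_card.1 hBq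
      have h2 : ((frattini G).subgroupOf A).index = q ^ k := by
        have h3 : (frattini G).relIndex A = (⊥ : Subgroup (G ⧸ frattini G)).relIndex B := by
          rw [← map_comap_eq_self_of_surjective hf B, ← relIndex_comap, MonoidHom.comap_bot,
            QuotientGroup.ker_mk']
        rw [← hk, ← relIndex_bot_left]
        exact h3
      have h3 := index_dvd_of_le (le_sup_right :
        (frattini G).subgroupOf A ≤ (S : Subgroup A) ⊔ (frattini G).subgroupOf A)
      have h4 := index_dvd_of_le (le_sup_left :
        (S : Subgroup A) ≤ (S : Subgroup A) ⊔ (frattini G).subgroupOf A)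
      rw [h2] at h3
      obtain ⟨j, -, hj⟩ := (Nat.dvd_prime_pow hq).1 h3
      rw [hj] at h4
      rw [← index_eq_one, hj]
      rcases j.eq_zero_or_pos with rfl | hj0
      · exact pow_zero q
      · exact absurd ((dvd_pow_self q hj0.ne').trans h4) S.not_dvd_index
    have h2 := congr_arg (Subgroup.map A.subtype) h1
    rw [Subgroup.map_sup, ← MonoidHom.range_eq_map, range_subtype, subgroupOf_map_subtype] at h2
    exact h2.ge.trans (sup_le_sup_left inf_le_left _)
  have h1 := hO q hq hqp _ (S.map_subtype_normal_of_le_sup_frattini hle) (S.isPGroup'.map _)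
  rw [h1, bot_sup_eq] at hle
  rw [← map_comap_eq_self_of_surjective hf B, eq_bot_iff, map_le_iff_le_comap, MonoidHom.comap_bot,
    QuotientGroup.ker_mk']
  exact hle

theorem eq_one_of_pow_eq_one_of_coprime {x : G} {m n : ℕ} (hm : x ^ m = 1) (hn : x ^ n = 1)
    (h : m.Coprime n) : x = 1 :=
  orderOf_eq_one_iff.1 (Nat.eq_one_of_dvd_coprimes h (orderOf_dvd_of_pow_eq_one hm)
    (orderOf_dvd_of_pow_eq_one hn))

theorem IsPGroup.eq_one_of_coprime {p : ℕ} {H : Subgroup G} (hH : IsPGroup p H) {x : G}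
    (hx : x ∈ H) {n : ℕ} (hn : x ^ n = 1) (h : n.Coprime p) : x = 1 := by
  obtain ⟨k, hk⟩ := hH ⟨x, hx⟩
  exact eq_one_of_pow_eq_one_of_coprime hn (congr_arg Subtype.val hk) (Nat.Coprime.pow_right k h)

theorem HasSmallCoatomCores.isPGroup_commutator [Finite G] (h : HasSmallCoatomCores G) {p : ℕ}
    (hp : p.Prime) (hO : IsPrimaryAt G p) : IsPGroup p (_root_.commutator G) := by
  refine IsPGroup.of_forall_prime_dvd fun q hq hd => ?_
  by_contra hqp
  have := Fact.mk hq
  obtain ⟨x, hx⟩ := exists_prime_orderOf_dvd_card' q hd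
  have hx1 : (x : G) ^ q = 1 := by rw [← coe_pow, ← hx, pow_orderOf_eq_one, coe_one]
  set C := (_root_.commutator G).map (QuotientGroup.mk' (frattini G)) with hC
  have hCn : C.Normal := Normal.map inferInstance _ (QuotientGroup.mk'_surjective _)
  have hab : C ≤ centralizer (C : Set (G ⧸ frattini G)) := by
    rw [← commutator_eq_bot_iff_le_centralizer, hC, ← map_commutator, eq_bot_iff,
      map_le_iff_le_comap, MonoidHom.comap_bot, QuotientGroup.ker_mk']
    exact h.commutator_commutator_le_frattini
  obtain ⟨L, hL, hmem⟩ := exists_normal_forall_mem_iff_pow_eq_one hCn hab q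
  have hLb := hO.quotient_frattini q hq hqp L hL
    (IsPGroup.of_forall_mem_pow_eq_one fun y hy => ((hmem y).1 hy).2)
  have hxL : QuotientGroup.mk' (frattini G) x ∈ L :=
    (hmem _).2 ⟨mem_map_of_mem _ x.2, by rw [← map_pow, hx1, map_one]⟩
  rw [hLb, mem_bot, ← MonoidHom.mem_ker, QuotientGroup.ker_mk'] at hxL
  have h1 := hO.isPGroup_frattini.eq_one_of_coprime hxL hx1 ((Nat.coprime_primes hq hp).2 hqp)
  rw [OneMemClass.coe_eq_one] at h1
  rw [h1, orderOf_one] at hx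
  exact hq.one_lt.ne hx

theorem Subgroup.index_dvd_of_not_commutator_le [Finite G] {R S : Subgroup G} [R.Normal] [S.Normal]
    (hRS : R ≤ S) (hu : (R.relIndex S).Prime) (hv : S.index.Prime)
    (hn : ¬ _root_.commutator G ≤ R) : S.index ∣ R.relIndex S - 1 := by
  have hf := QuotientGroup.mk'_surjective R
  set T := S.map (QuotientGroup.mk' R) with hT
  have hTn : T.Normal := Normal.map inferInstance _ hf
  have hcard : Nat.card T = R.relIndex S := by
    rw [← relIndex_bot_left, hT, ← relIndex_comap, MonoidHom.comap_bot, QuotientGroup.ker_mk']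
  have hidx : T.index = S.index := index_map_eq S hf (by rwa [QuotientGroup.ker_mk'])
  have hab : T ≤ centralizer (T : Set (G ⧸ R)) := by
    rw [← commutator_eq_bot_iff_le_centralizer, hT, ← map_commutator, eq_bot_iff,
      map_le_iff_le_comap, MonoidHom.comap_bot, QuotientGroup.ker_mk']
    exact commutator_le_of_relIndex_prime hu
  have h1 := index_centralizer_dvd hu hcard
  have h2 := index_dvd_of_le hab
  rw [hidx] at h2
  rcases (Nat.dvd_prime hv).1 h2 with h3 | h3
  · refine absurd ?_ hn
    rw [← Normal.quotient_commutative_iff_commutator_le]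
    rw [index_eq_one, centralizer_eq_top_iff_subset] at h3
    have := Fact.mk hv
    have hcyc : IsCyclic ((G ⧸ R) ⧸ T) := isCyclic_of_prime_card (p := S.index) hidx
    exact (QuotientGroup.mk' T).isMulCommutative_of_isCyclic_of_ker_le_center
      (by rw [QuotientGroup.ker_mk']; exact h3)
  · rwa [h3] at h1

theorem IsPrimeMulSmaller.commutator_pow_mem [Finite G] {R : Subgroup G} [R.Normal]
    (hR : IsPrimeMulSmaller R.index) {p e : ℕ} (hp : p.Prime)
    (hC : IsPGroup p (_root_.commutator G)) (he : ∀ r : ℕ, r.Prime → r ∣ p - 1 → r ∣ e) {x : G}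
    (hx : (orderOf x).Coprime p) (y : G) : ⁅x ^ e, y⁆ ∈ R := by
  by_cases hCR : _root_.commutator G ≤ R
  · exact hCR (commutator_mem_commutator (mem_top _) (mem_top _))
  obtain ⟨u, v, S, hu, hv, -, hS, hRS, hSi, hRi, -, hCS⟩ := hR.exists_normal_between
  have hpow : ∀ z ∈ S, z ^ u ∈ R := fun z hz => by
    have h1 := (R.subgroupOf S).pow_index_mem ⟨z, hz⟩
    rw [show (R.subgroupOf S).index = u from hRi] at h1
    exact mem_subgroupOf.1 h1
  have hup : u = p := by
    by_contra hne
    refine hCR fun c hc => ?_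
    obtain ⟨k, hk⟩ := hC ⟨c, hc⟩
    exact mem_of_pow_mem_of_pow_eq_one hu hp (Ne.symm hne) (Or.inr rfl) (congr_arg Subtype.val hk)
      (hpow c (hCS hc))
  subst hup
  have hve : v ∣ e := by
    rcases hv with rfl | hv
    · exact one_dvd e
    · refine he v hv ?_
      have h1 := index_dvd_of_not_commutator_le hRS (hRi ▸ hu) (hSi ▸ hv) hCR
      rwa [hSi, hRi] at h1
  have hxS : x ^ e ∈ S := by
    obtain ⟨m, rfl⟩ := hve
    rw [pow_mul]
    exact S.pow_mem (hSi ▸ S.pow_index_mem x) m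
  have hxR : x ^ e ∈ R := by
    obtain ⟨m, hm⟩ := exists_pow_eq_self_of_coprime
      (Nat.Coprime.coprime_dvd_right (orderOf_pow_dvd (x := x) e) hx.symm)
    exact hm ▸ R.pow_mem (hpow _ hxS) m
  exact commutator_le_left R ⊤ (commutator_mem_commutator hxR (mem_top y))

theorem HasSmallCoatomCores.pow_eq_one_of_coprime [Finite G] (h : HasSmallCoatomCores G) {p e : ℕ}
    (hp : p.Prime) (hO : IsPrimaryAt G p) (he : ∀ r : ℕ, r.Prime → r ∣ p - 1 → r ∣ e) {x : G}
    (hx : (orderOf x).Coprime p) : x ^ e = 1 := by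
  set z := QuotientGroup.mk' (frattini G) (x ^ e) with hz
  have hzx : orderOf z ∣ orderOf x :=
    (orderOf_map_dvd (QuotientGroup.mk' (frattini G)) (x ^ e)).trans (orderOf_pow_dvd e)
  have hcen : z ∈ center (G ⧸ frattini G) := by
    rw [mem_center_iff]
    intro y
    obtain ⟨y, rfl⟩ := QuotientGroup.mk'_surjective (frattini G) y
    have h1 : ⁅x ^ e, y⁆ ∈ frattini G := by
      refine (le_iInf₂ fun M hM => ?_ : zpowers ⁅x ^ e, y⁆ ≤ frattini G) (mem_zpowers _)
      exact zpowers_le.2 (M.normalCore_le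
        ((h M hM).commutator_pow_mem hp (h.isPGroup_commutator hp hO) he hx y))
    rw [← QuotientGroup.ker_mk' (frattini G), MonoidHom.mem_ker, map_commutatorElement,
      commutatorElement_eq_one_iff_mul_comm] at h1
    exact h1.symm
  have hz1 : z = 1 := by
    by_contra hne
    obtain ⟨q, hq, hd⟩ := Nat.exists_prime_and_dvd (mt orderOf_eq_one_iff.1 hne)
    have hqp : q ≠ p := by
      rintro rfl
      exact hq.one_lt.ne' (Nat.eq_one_of_dvd_coprimes hx (hd.trans hzx) dvd_rfl)
    have hw := orderOf_pow_orderOf_div (orderOf_pos z).ne' hd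
    set w := z ^ (orderOf z / q) with hwdef
    have hwc : zpowers w ≤ center (G ⧸ frattini G) := zpowers_le.2 (Subgroup.pow_mem _ hcen _)
    have hn : (zpowers w).Normal := ⟨fun a ha g => by
      rwa [mem_center_iff.1 (hwc ha) g, mul_inv_cancel_right]⟩
    have h1 := hO.quotient_frattini q hq hqp _ hn
      (isPGroup_zpowers (k := 1) (by rw [pow_one, ← hw, pow_orderOf_eq_one]))
    rw [zpowers_eq_bot.1 h1, orderOf_one] at hw
    exact hq.one_lt.ne hw
  rw [hz, ← MonoidHom.mem_ker, QuotientGroup.ker_mk'] at hz1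
  refine hO.isPGroup_frattini.eq_one_of_coprime hz1 (n := orderOf x) ?_ hx
  rw [← pow_mul, mul_comm, pow_mul, pow_orderOf_eq_one, one_pow]

theorem squarefree_prod_primeFactors (n : ℕ) : Squarefree (∏ r ∈ n.primeFactors, r) := by
  refine Finset.squarefree_prod_of_pairwise_isCoprime (fun a ha b hb hab => ?_)
    fun r hr => (Nat.prime_of_mem_primeFactors hr).squarefree
  exact Nat.coprime_iff_isRelPrime.1 ((Nat.coprime_primes (Nat.prime_of_mem_primeFactors ha)
    (Nat.prime_of_mem_primeFactors hb)).2 hab)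

theorem HasSmallCoatomCores.pow_mem_centralizer [Finite G] (h : HasSmallCoatomCores G) {p e : ℕ}
    (hp : p.Prime) (hO : IsPrimaryAt G p) (he : ∀ r : ℕ, r.Prime → r ∣ p - 1 → r ∣ e)
    {N : Subgroup G} (hN : N.Normal) (hb : N ≠ ⊥)
    (hmin : ∀ L : Subgroup G, L.Normal → L ≤ N → L = ⊥ ∨ L = N) (hpN : IsPGroup p N) (x : G) :
    x ^ e ∈ centralizer (N : Set G) ∧ _root_.commutator G ≤ centralizer (N : Set G) := by
  have := Fact.mk hp
  obtain ⟨k, m, hm, hxm⟩ := Nat.exists_eq_pow_mul_and_not_dvd (orderOf_pos x).ne' p hp.ne_one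
  have hcop : (orderOf (x ^ p ^ k)).Coprime p := by
    rw [orderOf_pow_of_dvd (pow_pos hp.pos k).ne' (hxm ▸ dvd_mul_right _ _), hxm,
      Nat.mul_div_cancel_left _ (pow_pos hp.pos k)]
    exact ((Nat.Prime.coprime_iff_not_dvd hp).2 hm).symm
  have h1 : (x ^ e) ^ p ^ k = 1 := by
    rw [← pow_mul, mul_comm, pow_mul]
    exact h.pow_eq_one_of_coprime hp hO he hcop
  have hOn : (zpowers (x ^ e) ⊔ _root_.commutator G).Normal :=
    Normal.of_commutator_le _ le_sup_right
  have hOp : IsPGroup p (zpowers (x ^ e) ⊔ _root_.commutator G : Subgroup G) :=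
    IsPGroup.to_sup_of_normal_right (isPGroup_zpowers h1) (h.isPGroup_commutator hp hO)
  have h2 := IsPGroup.le_centralizer_of_minimal hN hOn hb hmin hpN hOp
  exact ⟨h2 (le_sup_left (a := zpowers (x ^ e)) (mem_zpowers _)), le_sup_right.trans h2⟩

theorem forall_conj_eq_pow_of_commutator_le {N : Subgroup G} (hN : N.Normal)
    (hmin : ∀ L : Subgroup G, L.Normal → L ≤ N → L = ⊥ ∨ L = N)
    (hab : N ≤ centralizer (N : Set G)) (hC : _root_.commutator G ≤ centralizer (N : Set G))
    {x n : G} {k : ℕ} (hn : n ∈ N) (hn1 : n ≠ 1) (hk : x * n * x⁻¹ = n ^ k) {m : G} (hm : m ∈ N) :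
    x * m * x⁻¹ = m ^ k := by
  let L : Subgroup G :=
    { carrier := {m | m ∈ N ∧ x * m * x⁻¹ = m ^ k}
      one_mem' := ⟨N.one_mem, by simp⟩
      mul_mem' := by
        rintro a b ⟨ha, ha'⟩ ⟨hb, hb'⟩
        refine ⟨N.mul_mem ha hb, ?_⟩
        rw [← conj_mul, ha', hb', Commute.mul_pow (mem_centralizer_iff.1 (hab hb) a ha)]
      inv_mem' := by
        rintro a ⟨ha, ha'⟩
        refine ⟨N.inv_mem ha, ?_⟩
        rw [← conj_inv, ha', inv_pow] }
  have hL : L.Normal := by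
    refine ⟨fun m ⟨hm, hm'⟩ g => ⟨hN.conj_mem m hm g, ?_⟩⟩
    have hc : ⁅g⁻¹, x⁆ ∈ centralizer (N : Set G) :=
      hC (commutator_mem_commutator (mem_top _) (mem_top _))
    have h1 := mem_centralizer_iff.1 hc (x * m * x⁻¹) (hN.conj_mem m hm x)
    rw [commutatorElement_def] at h1
    rw [conj_pow, ← hm']
    calc x * (g * m * g⁻¹) * x⁻¹ = g * (g⁻¹ * x * g⁻¹⁻¹ * x⁻¹ * (x * m * x⁻¹)) *
          (g⁻¹ * x * g⁻¹⁻¹ * x⁻¹)⁻¹ * g⁻¹ := by group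
      _ = g * (x * m * x⁻¹) * g⁻¹ := by rw [← h1]; group
  have h1 := (hmin L hL fun a ha => ha.1).resolve_left (ne_bot_iff_exists_ne_one.2
    ⟨⟨n, hn, hk⟩, fun h => hn1 (congr_arg Subtype.val h)⟩)
  exact (h1.ge hm).2

theorem squarefree_index_centralizer_of_card_prime {N : Subgroup G} [Finite G] (hN : N.Normal)
    (hc : (Nat.card N).Prime) {e : ℕ} (hs : Squarefree e)
    (he : ∀ x : G, x ^ e ∈ centralizer (N : Set G)) :
    Squarefree (centralizer (N : Set G)).index := by
  have := Fact.mk hc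
  have hcyc : IsCyclic N := isCyclic_of_prime_card rfl
  have h1 : IsCyclic (MulAut N) :=
    isCyclic_of_surjective (IsCyclic.mulAutMulEquiv N).symm
      (IsCyclic.mulAutMulEquiv N).symm.surjective
  rw [← ker_conjNormal_eq_centralizer, index_ker]
  obtain ⟨⟨_, x, rfl⟩, hg⟩ := IsCyclic.exists_ofOrder_eq_natCard
    (α := (MulAut.conjNormal (H := N)).range)
  rw [← hg]
  refine hs.squarefree_of_dvd (orderOf_dvd_of_pow_eq_one (Subtype.ext ?_))
  change MulAut.conjNormal (H := N) x ^ e = 1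
  rw [← map_pow, ← MonoidHom.mem_ker, ker_conjNormal_eq_centralizer]
  exact he x

theorem HasSmallCoatomCores.card_prime_of_isPrimaryAt [Finite G] (h : HasSmallCoatomCores G) {p : ℕ}
    (hp : p.Prime) (hO : IsPrimaryAt G p) {N : Subgroup G} (hN : N.Normal) (hb : N ≠ ⊥)
    (hmin : ∀ L : Subgroup G, L.Normal → L ≤ N → L = ⊥ ∨ L = N) (hpow : ∀ n ∈ N, n ^ p = 1) :
    (Nat.card N).Prime ∧ Squarefree (centralizer (N : Set G)).index := by
  have hab := h.le_centralizer_of_minimal hN hb hmin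
  have hp1 : p - 1 ≠ 0 := (Nat.sub_pos_of_lt hp.one_lt).ne'
  have he : ∀ r : ℕ, r.Prime → r ∣ p - 1 → r ∣ ∏ r ∈ (p - 1).primeFactors, r := fun r hr hd =>
    Finset.dvd_prod_of_mem _ (Nat.mem_primeFactors.2 ⟨hr, hd, hp1⟩)
  have hC := h.pow_mem_centralizer hp hO he hN hb hmin (IsPGroup.of_forall_mem_pow_eq_one hpow)
  have hcard : (Nat.card N).Prime := by
    obtain ⟨n, hn⟩ := ne_bot_iff_exists_ne_one.1 hb
    have hn1 : (n : G) ≠ 1 := fun h => hn (Subtype.ext h)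
    have hz : (zpowers (n : G)).Normal := by
      refine normalizer_eq_top_iff.1 (eq_top_iff.2 fun x _ => ?_)
      refine mem_normalizer_zpowers_of_conj_mem ?_
      obtain ⟨d, hd⟩ := Nat.prod_primeFactors_dvd (p - 1)
      obtain ⟨m, hm, hm1, k, hk⟩ := exists_conj_eq_pow hp hN hb hab hpow (x := x) (by
        rw [hd, pow_mul]
        exact Subgroup.pow_mem _ (hC x).1 d)
      rw [forall_conj_eq_pow_of_commutator_le hN hmin hab (hC x).2 hm hm1 hk n.2]
      exact npow_mem_zpowers _ _
    have hzN := (hmin _ hz (zpowers_le.2 n.2)).resolve_left (mt zpowers_eq_bot.1 hn1)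
    have := Fact.mk hp
    rw [← hzN, Nat.card_zpowers, orderOf_eq_prime (hpow n n.2) hn1]
    exact hp
  exact ⟨hcard, squarefree_index_centralizer_of_card_prime hN hcard
    (squarefree_prod_primeFactors _) fun x => (hC x).1⟩

theorem Subgroup.comap_centralizer_map_le {N K : Subgroup G} [N.Normal] [K.Normal] (h : N ⊓ K = ⊥) :
    (centralizer (N.map (QuotientGroup.mk' K) : Set (G ⧸ K))).comap (QuotientGroup.mk' K) ≤
      centralizer (N : Set G) := by
  intro x hx
  rw [mem_centralizer_iff_commutator_eq_one]
  intro n hn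
  have h1 := mem_centralizer_iff_commutator_eq_one.1 (mem_comap.1 hx) _ (mem_map_of_mem _ hn)
  rw [← map_commutatorElement, ← MonoidHom.mem_ker, QuotientGroup.ker_mk'] at h1
  rw [← mem_bot, ← h]
  exact ⟨commutator_le_left N ⊤ (commutator_mem_commutator hn (mem_top x)), h1⟩

theorem Subgroup.map_mk_minimal {N K : Subgroup G} [K.Normal] (hN : N.Normal)
    (hmin : ∀ L : Subgroup G, L.Normal → L ≤ N → L = ⊥ ∨ L = N)
    (L : Subgroup (G ⧸ K)) (hL : L.Normal) (hLN : L ≤ N.map (QuotientGroup.mk' K)) :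
    L = ⊥ ∨ L = N.map (QuotientGroup.mk' K) := by
  have h1 : L = (L.comap (QuotientGroup.mk' K) ⊓ N).map (QuotientGroup.mk' K) := by
    rw [inf_comm, map_inf_comap', inf_eq_right.2 hLN]
  rcases hmin (L.comap (QuotientGroup.mk' K) ⊓ N) inferInstance inf_le_right with h2 | h2
  · exact Or.inl (by rw [h1, h2, Subgroup.map_bot])
  · exact Or.inr (by rw [h1, h2])

/-- Minimal normal subgroups have prime order and induce automorphism groups of square-free order. -/
theorem HasSmallCoatomCores.card_prime_of_minimal {G : Type*} [Group G] [Finite G]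
    (h : HasSmallCoatomCores G)
    {N : Subgroup G} (hN : N.Normal) (hb : N ≠ ⊥)
    (hmin : ∀ L : Subgroup G, L.Normal → L ≤ N → L = ⊥ ∨ L = N) :
    (Nat.card N).Prime ∧ Squarefree (centralizer (N : Set G)).index := by
  induction hn : Nat.card G using Nat.strong_induction_on generalizing G with
  | _ n ih =>
    obtain ⟨p, hp, hpow⟩ := exists_prime_forall_pow_eq_one hN hb hmin
      (h.le_centralizer_of_minimal hN hb hmin)
    by_cases hO : IsPrimaryAt G p
    · exact h.card_prime_of_isPrimaryAt hp hO hN hb hmin hpow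
    unfold IsPrimaryAt at hO
    push Not at hO
    obtain ⟨q, hq, hqp, K, hK, hKq, hKb⟩ := hO
    have hNK : N ⊓ K = ⊥ := by
      rw [eq_bot_iff]
      intro x hx
      exact hKq.eq_one_of_coprime hx.2 (hpow x hx.1) ((Nat.coprime_primes hp hq).2 (Ne.symm hqp))
    have hinj : Function.Injective ((QuotientGroup.mk' K).domRestrict N) := by
      rw [← MonoidHom.ker_eq_bot_iff, MonoidHom.ker_domRestrict, QuotientGroup.ker_mk']
      rw [subgroupOf_eq_bot, disjoint_iff, inf_comm]
      exact hNK
    have hcard : Nat.card (N.map (QuotientGroup.mk' K)) = Nat.card N := by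
      rw [← MonoidHom.domRestrict_range]
      exact (Nat.card_congr (Equiv.ofInjective _ hinj)).symm
    have hlt : Nat.card (G ⧸ K) < n := hn ▸ index_lt_card_of_ne_bot hKb
    have hbb : N.map (QuotientGroup.mk' K) ≠ ⊥ := fun h0 => hb (by
      rw [h0, card_bot] at hcard
      exact eq_bot_of_card_eq _ hcard.symm)
    have h1 := ih _ hlt (h.quotient K) (Normal.map hN _ (QuotientGroup.mk'_surjective K)) hbb
      (map_mk_minimal hN hmin) rfl
    refine ⟨hcard ▸ h1.1, h1.2.squarefree_of_dvd ?_⟩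
    rw [← index_comap_of_surjective _ (QuotientGroup.mk'_surjective K)]
    exact index_dvd_of_le (comap_centralizer_map_le hNK)

theorem IsChiefFactor.map_minimal {H K : Subgroup G} (hc : IsChiefFactor H K) [K.Normal] :
    (H.map (QuotientGroup.mk' K)).Normal ∧ H.map (QuotientGroup.mk' K) ≠ ⊥ ∧
      ∀ L : Subgroup (G ⧸ K), L.Normal → L ≤ H.map (QuotientGroup.mk' K) →
        L = ⊥ ∨ L = H.map (QuotientGroup.mk' K) := by
  obtain ⟨-, hH, hKH, hmin⟩ := hc
  have hf := QuotientGroup.mk'_surjective K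
  have hHc : (H.map (QuotientGroup.mk' K)).comap (QuotientGroup.mk' K) = H :=
    comap_map_eq_self (by rw [QuotientGroup.ker_mk']; exact hKH.le)
  refine ⟨Normal.map hH _ hf, fun h => ?_, fun L hL hLH => ?_⟩
  · rw [eq_bot_iff, map_le_iff_le_comap, MonoidHom.comap_bot, QuotientGroup.ker_mk'] at h
    exact hKH.not_ge h
  · have hKL : K ≤ L.comap (QuotientGroup.mk' K) :=
      (QuotientGroup.ker_mk' K).ge.trans (comap_mono bot_le)
    have hLH' : L.comap (QuotientGroup.mk' K) ≤ H := hHc ▸ comap_mono hLH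
    rw [← map_comap_eq_self_of_surjective hf L]
    rcases hKL.eq_or_lt with h | h
    · left
      rw [← h, eq_bot_iff, map_le_iff_le_comap, MonoidHom.comap_bot, QuotientGroup.ker_mk']
    · right
      rw [hmin _ (hL.comap _) h hLH']

theorem IsChiefFactor.index_chiefCentralizer {H K : Subgroup G} (hc : IsChiefFactor H K)
    [K.Normal] : (chiefCentralizer H K hc.1).index =
      (centralizer (H.map (QuotientGroup.mk' K) : Set (G ⧸ K))).index :=
  index_comap_of_surjective _ (QuotientGroup.mk'_surjective K)

theorem exists_isChiefFactor [Finite G] {K : Subgroup G} (hK : K.Normal) (h : K ≠ ⊤) :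
    ∃ H, IsChiefFactor H K := by
  obtain ⟨H, hH⟩ := (Set.toFinite {L : Subgroup G | L.Normal ∧ K < L}).exists_minimal
    ⟨⊤, inferInstance, h.lt_top⟩
  exact ⟨H, hK, hH.prop.1, hH.prop.2, fun N hN hKN hNH => hNH.antisymm (hH.2 ⟨hN, hKN⟩ hNH)⟩

/-- The inclusions of normal subgroups with cyclic quotient. -/
def cyclicNormalStep (G : Type*) [Group G] : SetRel (Subgroup G) (Subgroup G) :=
  {x | ∃ _ : x.1.Normal, x.2.Normal ∧ x.1 ≤ x.2 ∧ IsCyclic (x.2.map (QuotientGroup.mk' x.1))}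

theorem isSupersoluble_of_isCyclic_chief [Finite G]
    (h : ∀ H K : Subgroup G, ∀ hc : IsChiefFactor H K,
      have := hc.1
      IsCyclic (H.map (QuotientGroup.mk' K))) : IsSupersoluble G := by
  obtain ⟨K, hK⟩ := (Set.toFinite {K : Subgroup G | K.Normal ∧
    ∃ s : RelSeries (cyclicNormalStep G), s.head = ⊥ ∧ s.last = K}).exists_maximal
    ⟨⊥, inferInstance, RelSeries.singleton _ ⊥, rfl, rfl⟩
  obtain ⟨⟨hKn, s, hs0, hsK⟩, hmax⟩ := hK
  have hKtop : K = ⊤ := by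
    by_contra hne
    obtain ⟨H, hc⟩ := exists_isChiefFactor hKn hne
    have hstep : (s.last, H) ∈ cyclicNormalStep G := by
      subst hsK
      exact ⟨hKn, hc.2.1, hc.2.2.1.le, h H _ hc⟩
    exact hc.2.2.1.not_ge (hmax ⟨hc.2.1, s.snoc H hstep, by rw [RelSeries.head_snoc, hs0],
      RelSeries.last_snoc _ _ _⟩ hc.2.2.1.le)
  refine ⟨s.length, s.toFun, fun i => ?_, hs0, hsK.trans hKtop, fun i => ?_⟩
  · induction i using Fin.cases with
    | zero =>
      change s.head.Normal
      rw [hs0]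
      infer_instance
    | succ i => exact (s.step i).choose_spec.1
  · obtain ⟨_, -, hle, hcyc⟩ := s.step i
    exact ⟨hle, hcyc⟩

theorem HasSmallCoatomCores.isNearlyNilpotent [Finite G] (h : HasSmallCoatomCores G) :
    IsNearlyNilpotent G ∧ IsStronglySupersoluble G := by
  have hprime : ∀ H K : Subgroup G, ∀ hc : IsChiefFactor H K,
      have := hc.1
      (Nat.card (H.map (QuotientGroup.mk' K))).Prime ∧
        Squarefree (chiefCentralizer H K hc.1).index := by
    intro H K hc
    have := hc.1
    obtain ⟨h1, h2, h3⟩ := hc.map_minimal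
    rw [hc.index_chiefCentralizer]
    exact (h.quotient K).card_prime_of_minimal h1 h2 h3
  have hss : IsSupersoluble G := isSupersoluble_of_isCyclic_chief fun H K hc => by
    have := hc.1
    have := Fact.mk (hprime H K hc).1
    exact isCyclic_of_prime_card rfl
  refine ⟨⟨hss, fun H K hc hF => ?_⟩, hss, fun H K hc => (hprime H K hc).2⟩
  have := hc.1
  obtain ⟨h1, h2, h3⟩ := hc.map_minimal
  rw [hc.index_chiefCentralizer]
  exact ((h.quotient K).card_prime_of_not_le_frattini h1 h2 h3 hF).2

theorem IsCoatom.isNMaximal_one {M : Subgroup G} (hM : IsCoatom M) : IsNMaximal 1 M :=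
  ⟨![⊤, M], rfl, rfl, fun i => by
    fin_cases i
    exact isMaximalIn_iff_covBy.2 (covBy_top_iff.2 hM)⟩

theorem IsCoatom.isNMaximal_two {M T : Subgroup G} (hM : IsCoatom M) (hT : T ⋖ M) :
    IsNMaximal 2 T :=
  ⟨![⊤, M, T], rfl, rfl, fun i => by
    fin_cases i
    · exact isMaximalIn_iff_covBy.2 (covBy_top_iff.2 hM)
    · exact isMaximalIn_iff_covBy.2 hT⟩

/-- Proposition 2.11: if every maximal subgroup of `G`, or every 2-maximal subgroup of
`G`, is either modular or S-quasinormal in `G`, then `G` is nearly nilpotent, and hence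
strongly supersoluble. -/
theorem nearlyNilpotent_of_maximal_or_twoMaximal_modular_or_squasinormal
    {G : Type*} [Group G] [Finite G]
    (h : (∀ M : Subgroup G, IsNMaximal 1 M → IsModularSubgroup M ∨ IsSQuasinormal M) ∨
         (∀ M : Subgroup G, IsNMaximal 2 M → IsModularSubgroup M ∨ IsSQuasinormal M)) :
    IsNearlyNilpotent G ∧ IsStronglySupersoluble G := by
  refine HasSmallCoatomCores.isNearlyNilpotent ?_
  rcases h with h | h
  · exact HasSmallCoatomCores.of_isModular_or_isSQuasinormal fun M hM => h M hM.isNMaximal_one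
  · exact HasSmallCoatomCores.of_hasGoodTwoMaximals fun M T hM hT => h T (hM.isNMaximal_two hT)
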